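/- arXiv:1508.05567 — 6 statements merged into one kernel-verified Lean document; each statement's English description precedes it below -/
import Mathlib

section
/- Let (G = (V, E), 𝒞) be an instance of Star Strong Connectivity. Then every quasiperfect set Q ⊆ 𝒞 is a subset of some perfect set Q' ⊆ 𝒞 (i.e., Q ⊆ Q' and Q' is perfect). -/
def SReach {V : Type*} (E : Finset (V × V)) : V → V → Prop :=
  Relation.ReflTransGen (fun u v => (u, v) ∈ E)

def SConn {V : Type*} (E : Finset (V × V)) : Prop :=
  ∀ u v : V, SReach E u v

def IsDigraph {V : Type*} (E : Finset (V × V)) : Prop :=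
  ∀ a ∈ E, a.1 ≠ a.2

def IsStar {V : Type*} (F : Finset (V × V)) : Prop :=
  F.Nonempty ∧ (∀ a ∈ F, ∀ b ∈ F, a.1 = b.1) ∧ (∀ a ∈ F, a.1 ≠ a.2)

def srcSet {V : Type*} [DecidableEq V] (Q : Finset (Finset (V × V))) : Finset V :=
  Q.biUnion (fun F => F.image Prod.fst)

def Quasiperfect {V : Type*} [DecidableEq V] (Q : Finset (Finset (V × V))) : Prop :=
  (∀ F ∈ Q, ∀ G ∈ Q, F ≠ G → ∀ a ∈ F, ∀ b ∈ G, a.1 ≠ b.1) ∧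
  (∀ u ∈ srcSet Q, ∀ v ∈ srcSet Q,
    Relation.ReflTransGen
      (fun x y => x ∈ srcSet Q ∧ y ∈ srcSet Q ∧ (x, y) ∈ Q.biUnion id) u v)

def PerfectSet {V : Type*} [DecidableEq V] (Q : Finset (Finset (V × V))) : Prop :=
  Quasiperfect Q ∧ ∀ F ∈ Q, ∀ a ∈ F, a.2 ∈ srcSet Q

def StarArc {V : Type*} [DecidableEq V] (Q : Finset (Finset (V × V))) (x y : V) : Prop :=
  (x, y) ∈ Q.biUnion id

lemma mem_srcSet {V : Type*} [DecidableEq V] {Q : Finset (Finset (V × V))} {v : V} :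
    v ∈ srcSet Q ↔ ∃ F ∈ Q, ∃ a ∈ F, a.1 = v := by
  simp only [srcSet, Finset.mem_biUnion, Finset.mem_image]

/-- Stars with pairwise distinct sources whose sources all reach `s` extend, within a collection
covering a strongly connected digraph, to such a set of stars in which every vertex is a source. -/
lemma exists_spanning_extension {V : Type*} [DecidableEq V]
    {E : Finset (V × V)} {𝒞 Q : Finset (Finset (V × V))} (hconn : SConn E)
    (hstar : ∀ F ∈ 𝒞, IsStar F) (hcover : 𝒞.biUnion id = E) (hQ : Q ⊆ 𝒞)
    (hdist : ∀ F ∈ Q, ∀ G ∈ Q, F ≠ G → ∀ a ∈ F, ∀ b ∈ G, a.1 ≠ b.1)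
    {s : V} (hs : s ∈ srcSet Q)
    (hreach : ∀ v ∈ srcSet Q, Relation.ReflTransGen (StarArc Q) v s) :
    ∃ P : Finset (Finset (V × V)), Q ⊆ P ∧ P ⊆ 𝒞 ∧
      (∀ F ∈ P, ∀ G ∈ P, F ≠ G → ∀ a ∈ F, ∀ b ∈ G, a.1 ≠ b.1) ∧
      (∀ v, v ∈ srcSet P) ∧ ∀ v, Relation.ReflTransGen (StarArc P) v s := by
  classical
  let A := 𝒞.powerset.filter fun P => Q ⊆ P ∧
    (∀ F ∈ P, ∀ G ∈ P, F ≠ G → ∀ a ∈ F, ∀ b ∈ G, a.1 ≠ b.1) ∧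
    ∀ v ∈ srcSet P, Relation.ReflTransGen (StarArc P) v s
  have hQA : Q ∈ A := by
    simp only [A, Finset.mem_filter, Finset.mem_powerset]
    exact ⟨hQ, subset_rfl, hdist, hreach⟩
  obtain ⟨P, hPA, hmax⟩ := A.exists_max_image Finset.card ⟨Q, hQA⟩
  obtain ⟨hP, hQP, hPd, hPr⟩ : P ⊆ 𝒞 ∧ Q ⊆ P ∧
      (∀ F ∈ P, ∀ G ∈ P, F ≠ G → ∀ a ∈ F, ∀ b ∈ G, a.1 ≠ b.1) ∧
      ∀ v ∈ srcSet P, Relation.ReflTransGen (StarArc P) v s := by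
    simpa only [A, Finset.mem_filter, Finset.mem_powerset] using hPA
  have hall : ∀ v, v ∈ srcSet P := by
    intro v
    refine Relation.ReflTransGen.head_induction_on (hconn v s) ?_ ?_
    · obtain ⟨F, hF, h⟩ := mem_srcSet.1 hs
      exact mem_srcSet.2 ⟨F, hQP hF, h⟩
    · intro v w hvw _ hw
      by_contra hv
      rw [← hcover, Finset.mem_biUnion] at hvw
      obtain ⟨F, hF, hvF⟩ := hvw
      replace hvF : (v, w) ∈ F := hvF
      have hsrc : ∀ a ∈ F, a.1 = v := fun a ha => (hstar F hF).2.1 a ha _ hvF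
      have hFP : F ∉ P := fun h => hv (mem_srcSet.2 ⟨F, h, _, hvF, rfl⟩)
      have hmono : ∀ x y, StarArc P x y → StarArc (insert F P) x y := fun x y h =>
        Finset.biUnion_subset_biUnion_of_subset_left _ (Finset.subset_insert F P) h
      have hold : ∀ v ∈ srcSet P, Relation.ReflTransGen (StarArc (insert F P)) v s :=
        fun v hv => Relation.ReflTransGen.mono hmono _ _ (hPr v hv)
      have hIns : insert F P ∈ A := by
        simp only [A, Finset.mem_filter, Finset.mem_powerset]
        refine ⟨Finset.insert_subset hF hP, hQP.trans (Finset.subset_insert _ _), ?_, ?_⟩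
        · intro G hG H hH hGH a ha b hb hab
          rcases Finset.mem_insert.1 hG with rfl | hGP <;>
            rcases Finset.mem_insert.1 hH with rfl | hHP
          · exact hGH rfl
          · exact hv (mem_srcSet.2 ⟨H, hHP, b, hb, hab ▸ hsrc a ha⟩)
          · exact hv (mem_srcSet.2 ⟨G, hGP, a, ha, hab ▸ hsrc b hb⟩)
          · exact hPd G hGP H hHP hGH a ha b hb hab
        · intro x hx
          obtain ⟨G, hG, a, ha, rfl⟩ := mem_srcSet.1 hx
          rcases Finset.mem_insert.1 hG with rfl | hG
          · rw [hsrc a ha]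
            exact (hold w hw).head
              (Finset.mem_biUnion.2 ⟨G, Finset.mem_insert_self _ _, hvF⟩)
          · exact hold _ (mem_srcSet.2 ⟨G, hG, a, ha, rfl⟩)
      have := hmax _ hIns
      rw [Finset.card_insert_of_notMem hFP] at this
      omega
  exact ⟨P, hQP, hP, hPd, hall, fun v => hPr v (hall v)⟩

theorem stmt3 {V : Type*} [Fintype V] [DecidableEq V]
    (E : Finset (V × V)) (𝒞 : Finset (Finset (V × V)))
    (hdig : IsDigraph E) (hconn : SConn E)
    (hstar : ∀ F ∈ 𝒞, IsStar F) (hcover : 𝒞.biUnion id = E)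
    (Q : Finset (Finset (V × V))) (hQ : Q ⊆ 𝒞) (hqp : Quasiperfect Q) :
    ∃ Q' : Finset (Finset (V × V)), Q ⊆ Q' ∧ Q' ⊆ 𝒞 ∧ PerfectSet Q' := by
  classical
  rcases (srcSet Q).eq_empty_or_nonempty with hemp | ⟨s, hs⟩
  · refine ⟨Q, subset_rfl, hQ, hqp, fun F hF a ha => ?_⟩
    have : a.1 ∈ srcSet Q := mem_srcSet.2 ⟨F, hF, a, ha, rfl⟩
    simp [hemp] at this
  have hQreach : ∀ u ∈ srcSet Q, ∀ v ∈ srcSet Q, Relation.ReflTransGen (StarArc Q) u v :=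
    fun u hu v hv => Relation.ReflTransGen.mono (fun _ _ h => h.2.2) _ _ (hqp.2 u hu v hv)
  obtain ⟨P, hQP, hP, hPd, hall, hto⟩ := exists_spanning_extension hconn hstar hcover hQ hqp.1 hs
    fun v hv => hQreach v hv s hs
  let T := P.filter fun F => ∃ a ∈ F, Relation.ReflTransGen (StarArc P) s a.1
  have hTP : T ⊆ P := Finset.filter_subset _ _
  have hT : ∀ v, v ∈ srcSet T ↔ Relation.ReflTransGen (StarArc P) s v := by
    intro v
    constructor
    · intro hv
      obtain ⟨F, hF, a, ha, rfl⟩ := mem_srcSet.1 hv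
      obtain ⟨hFP, b, hb, hsb⟩ := Finset.mem_filter.1 hF
      rwa [(hstar F (hP hFP)).2.1 a ha b hb]
    · intro hv
      obtain ⟨F, hF, a, ha, rfl⟩ := mem_srcSet.1 (hall v)
      exact mem_srcSet.2 ⟨F, Finset.mem_filter.2 ⟨hF, a, ha, hv⟩, a, ha, rfl⟩
  refine ⟨T, fun F hF => ?_, hTP.trans hP,
    ⟨fun F hF G hG => hPd F (hTP hF) G (hTP hG), fun u hu v hv => ?_⟩, fun F hF a ha => ?_⟩
  · obtain ⟨a, ha⟩ := (hstar F (hQ hF)).1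
    refine Finset.mem_filter.2 ⟨hQP hF, a, ha, ?_⟩
    exact Relation.ReflTransGen.mono
      (fun _ _ h => Finset.biUnion_subset_biUnion_of_subset_left _ hQP h) _ _
      (hQreach s hs a.1 (mem_srcSet.2 ⟨F, hF, a, ha, rfl⟩))
  · have huv : Relation.ReflTransGen (StarArc P) u v := (hto u).trans ((hT v).1 hv)
    clear hv
    induction huv with
    | refl => exact .refl
    | @tail x y hux hxy ih =>
      have hx := ((hT u).1 hu).trans hux
      have hxT := (hT x).2 hx
      have hyT := (hT y).2 (hx.tail hxy)
      obtain ⟨F, hF, hxF⟩ := Finset.mem_biUnion.1 hxy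
      exact ih.tail ⟨hxT, hyT,
        Finset.mem_biUnion.2 ⟨F, Finset.mem_filter.2 ⟨hF, _, hxF, hx⟩, hxF⟩⟩
  · have hs' := (hT a.1).1 (mem_srcSet.2 ⟨F, hF, a, ha, rfl⟩)
    exact (hT a.2).2 (hs'.tail (Finset.mem_biUnion.2 ⟨F, hTP hF, ha⟩))
end

section
/- Every finite strongly connected digraph G = (V, E) with |V| ≥ 2 contains a directed cycle C together with a vertex v̄ on C such that every out-neighbor of v̄ (every vertex u with v̄u ∈ E) lies on C. -/
def IsDirCycle {V : Type*} (E : Finset (V × V)) (c : List V) : Prop :=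
  2 ≤ c.length ∧ c.Nodup ∧ ∀ p ∈ c.zip (c.rotate 1), p ∈ E

theorem List.IsChain.of_mem_zip_append_singleton {α : Type*} {R : α → α → Prop} {w : α} :
    ∀ {t : List α} {a : α}, (a :: t ++ [w]).IsChain R →
      ∀ p ∈ (a :: t).zip (t ++ [w]), R p.1 p.2
  | [], a, h, p, hp => by simp_all
  | b :: t, a, h, p, hp => by
    simp only [List.cons_append, List.isChain_cons_cons, List.zip_cons_cons,
      List.mem_cons] at h hp
    rcases hp with rfl | hp
    · exact h.1
    · exact of_mem_zip_append_singleton (t := t) (a := b) h.2 p hp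

theorem exists_nodup_isChain_getLast_forall_mem {α : Type*} [Finite α] [Nonempty α]
    (R : α → α → Prop) :
    ∃ (l : List α) (v : α), l.Nodup ∧ l.IsChain R ∧ l.getLast? = some v ∧
      ∀ u, R v u → u ∈ l := by
  have := Fintype.ofFinite α
  have hfin : {l : List α | l.Nodup ∧ l.IsChain R}.Finite :=
    (List.finite_length_le α (Fintype.card α)).subset fun l hl => hl.1.length_le_card
  obtain ⟨a⟩ := ‹Nonempty α›
  obtain ⟨l, ⟨hnd, hch⟩, hmax⟩ := Set.exists_max_image _ List.length hfin
    ⟨[a], by simp⟩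
  have hne : l ≠ [] := by
    rintro rfl
    simpa using hmax [a] (by simp)
  refine ⟨l, l.getLast hne, hnd, hch, List.getLast?_eq_some_getLast hne, fun u hu => ?_⟩
  by_contra hul
  have := hmax (l ++ [u]) ⟨hnd.append (List.nodup_singleton u) (by simpa using hul),
    hch.append (List.isChain_singleton u) (by simp [List.getLast?_eq_some_getLast hne, hu])⟩
  simp at this

theorem SConn.exists_mem {V : Type*} {E : Finset (V × V)} [Nontrivial V] (h : SConn E) (v : V) :
    ∃ u, (v, u) ∈ E := by
  obtain ⟨w, hw⟩ := exists_ne v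
  rcases (h v w).cases_head with rfl | ⟨u, hu, -⟩
  · exact absurd rfl hw
  · exact ⟨u, hu⟩

theorem stmt4 {V : Type*} [Fintype V] [DecidableEq V]
    (E : Finset (V × V))
    (hdig : IsDigraph E) (hconn : SConn E) (hcard : 2 ≤ Fintype.card V) :
    ∃ (c : List V) (v : V), IsDirCycle E c ∧ v ∈ c ∧
      ∀ u : V, (v, u) ∈ E → u ∈ c := by
  have : Nontrivial V := Fintype.one_lt_card_iff_nontrivial.mp hcard
  obtain ⟨l, v, hnd, hch, hlast, hmem⟩ :=
    exists_nodup_isChain_getLast_forall_mem fun a b : V => (a, b) ∈ E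
  have hsuf := List.dropWhile_suffix (l := l) fun x => decide ((v, x) ∉ E)
  have hout : ∀ u, (v, u) ∈ E → u ∈ l.dropWhile fun x => decide ((v, x) ∉ E) := by
    intro u hu
    have h := hmem u hu
    rw [← List.takeWhile_append_dropWhile (p := fun x => decide ((v, x) ∉ E)) (l := l),
      List.mem_append] at h
    exact h.resolve_left fun h => by simpa [hu] using List.mem_takeWhile_imp h
  have hhead : ∀ w ∈ (l.dropWhile fun x => decide ((v, x) ∉ E)).head?, (v, w) ∈ E := by
    intro w hw
    have h := List.head?_dropWhile_not (fun x => decide ((v, x) ∉ E)) l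
    rw [Option.mem_def.mp hw] at h
    simpa using h
  obtain ⟨u, hu⟩ := hconn.exists_mem v
  generalize (l.dropWhile fun x => decide ((v, x) ∉ E)) = c at hsuf hout hhead
  obtain _ | ⟨w, t⟩ := c
  · simpa using hout u hu
  have hwE : (v, w) ∈ E := hhead w rfl
  have hlast' : (w :: t).getLast? = some v := by
    obtain ⟨s, rfl⟩ := hsuf
    simpa [List.getLast?_append] using hlast
  have hv : v ∈ w :: t := List.mem_of_getLast? hlast'
  refine ⟨w :: t, v, ⟨?_, hnd.sublist hsuf.sublist, ?_⟩, hv, hout⟩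
  · obtain _ | ⟨b, t⟩ := t
    · obtain rfl : v = w := by simpa using hv
      exact absurd rfl (hdig _ hwE)
    · simp
  · have hcyc : (w :: t ++ [w]).IsChain fun a b : V => (a, b) ∈ E :=
      (hch.suffix hsuf).append (List.isChain_singleton w) (by simp [hlast', hwE])
    simpa using hcyc.of_mem_zip_append_singleton
end

section
/- Let G = (V, E) be a finite strongly connected bidirected digraph (uv ∈ E implies vu ∈ E) with |V| ≥ 3. Call a vertex a leaf if it has exactly one neighbor, where u is a neighbor of v if uv ∈ E or vu ∈ E. Then G contains a directed cycle C and vertices v̄, w̄ on C (not necessarily distinct) such that: (1) neither v̄ nor w̄ is a leaf, and (2) every neighbor of v̄ and every neighbor of w̄ is either a vertex of C or a leaf. -/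
def nbrFinset {V : Type*} [Fintype V] [DecidableEq V] (E : Finset (V × V)) (v : V) :
    Finset V :=
  Finset.univ.filter (fun u => (u, v) ∈ E ∨ (v, u) ∈ E)

def IsLeafVertex {V : Type*} [Fintype V] [DecidableEq V] (E : Finset (V × V)) (v : V) : Prop :=
  (nbrFinset E v).card = 1

theorem List.exists_last_satisfying {α : Type*} (P : α → Prop) (l : List α)
    (h : ∃ x ∈ l, P x) : ∃ l₁ x l₂, l = l₁ ++ x :: l₂ ∧ P x ∧ ∀ y ∈ l₂, ¬ P y := by
  induction l using List.reverseRecOn with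
  | nil => simp at h
  | append_singleton l a ih =>
    by_cases ha : P a
    · exact ⟨l, a, [], by simp, ha, by simp⟩
    · obtain ⟨x, hx, hPx⟩ := h
      have hxl : x ∈ l := by
        rcases List.mem_append.1 hx with hx | hx
        · exact hx
        · rw [List.mem_singleton] at hx
          exact absurd (hx ▸ hPx) ha
      obtain ⟨l₁, z, l₂, rfl, hz, hl₂⟩ := ih ⟨x, hxl, hPx⟩
      refine ⟨l₁, z, l₂ ++ [a], by simp, hz, fun y hy => ?_⟩
      rcases List.mem_append.1 hy with hy | hy
      · exact hl₂ y hy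
      · rw [List.mem_singleton] at hy
        exact hy ▸ ha

theorem List.IsChain.rel_of_mem_zip {α : Type*} {R : α → α → Prop} {l : List α} {a b : α}
    (h : List.IsChain R (a :: (l ++ [b]))) : ∀ p ∈ (a :: l).zip (l ++ [b]), R p.1 p.2 := by
  induction l generalizing a with
  | nil => simpa using h
  | cons c l ih =>
    rw [List.cons_append, List.isChain_cons_cons] at h
    intro p hp
    rw [List.cons_append, List.zip_cons_cons, List.mem_cons] at hp
    rcases hp with rfl | hp
    · exact h.1
    · exact ih h.2 p hp

theorem mem_nbrFinset_iff {V : Type*} [Fintype V] [DecidableEq V] {E : Finset (V × V)}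
    (hbi : ∀ a ∈ E, (a.2, a.1) ∈ E) {u v : V} : u ∈ nbrFinset E v ↔ (v, u) ∈ E := by
  simp only [nbrFinset, Finset.mem_filter, Finset.mem_univ, true_and]
  exact ⟨fun h => h.elim (fun h => hbi _ h) id, Or.inr⟩

theorem SConn.exists_arc {V : Type*} [Nontrivial V] {E : Finset (V × V)} (hconn : SConn E)
    (v : V) : ∃ u, (v, u) ∈ E := by
  obtain ⟨w, hw⟩ := exists_ne v
  rcases Relation.ReflTransGen.cases_head (hconn v w) with h | ⟨u, hu, -⟩
  · exact absurd h.symm hw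
  · exact ⟨u, hu⟩

theorem SConn.exists_not_isLeafVertex {V : Type*} [Fintype V] [DecidableEq V]
    {E : Finset (V × V)} (hbi : ∀ a ∈ E, (a.2, a.1) ∈ E) (hconn : SConn E)
    (hcard : 3 ≤ Fintype.card V) : ∃ v, ¬ IsLeafVertex E v := by
  by_contra! hleaf
  have : Nontrivial V := Fintype.one_lt_card_iff_nontrivial.1 (by omega)
  obtain ⟨a⟩ : Nonempty V := inferInstance
  obtain ⟨b, hab⟩ := hconn.exists_arc a
  have unique : ∀ {v x y : V}, (v, x) ∈ E → (v, y) ∈ E → x = y := fun {v x y} hx hy =>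
    Finset.card_le_one.1 (hleaf v).le x ((mem_nbrFinset_iff hbi).2 hx) y
      ((mem_nbrFinset_iff hbi).2 hy)
  have hmem : ∀ w, w = a ∨ w = b := by
    intro w
    have hw : SReach E a w := hconn a w
    induction hw with
    | refl => exact Or.inl rfl
    | tail _ hxy ih =>
      rcases ih with rfl | rfl
      · exact Or.inr (unique hxy hab)
      · exact Or.inl (unique hxy (hbi _ hab))
  have hsub : (Finset.univ : Finset V) ⊆ {a, b} := fun w _ => by simpa using hmem w
  have := (Finset.card_le_card hsub).trans Finset.card_le_two
  rw [Finset.card_univ] at this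
  omega

/-- A longest path inside a vertex set: its initial vertex has no neighbor in the set outside
the path. -/
theorem exists_maximal_path {V : Type*} [Fintype V] (R : V → V → Prop) (P : V → Prop)
    {v : V} (hv : P v) : ∃ (a : V) (l : List V), (a :: l).Nodup ∧ List.IsChain R (a :: l) ∧
      (∀ x ∈ a :: l, P x) ∧ ∀ u, P u → R u a → u ∈ a :: l := by
  by_contra! h
  have key : ∀ n : ℕ, ∃ (a : V) (l : List V), (a :: l).Nodup ∧ List.IsChain R (a :: l) ∧
      (∀ x ∈ a :: l, P x) ∧ l.length = n := by
    intro n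
    induction n with
    | zero => exact ⟨v, [], by simp, by simp, by simpa using hv, rfl⟩
    | succ n ih =>
      obtain ⟨a, l, hnd, hch, hP, hlen⟩ := ih
      obtain ⟨u, hu, hua, hul⟩ := h a l hnd hch hP
      refine ⟨u, a :: l, List.nodup_cons.2 ⟨hul, hnd⟩, List.isChain_cons_cons.2 ⟨hua, hch⟩,
        fun x hx => ?_, by simp [hlen]⟩
      rcases List.mem_cons.1 hx with rfl | hx
      · exact hu
      · exact hP x hx
  obtain ⟨a, l, hnd, -, -, hlen⟩ := key (Fintype.card V)
  have := hnd.length_le_card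
  simp only [List.length_cons] at this
  omega

theorem stmt5 {V : Type*} [Fintype V] [DecidableEq V]
    (E : Finset (V × V))
    (hdig : IsDigraph E) (hbi : ∀ a ∈ E, (a.2, a.1) ∈ E)
    (hconn : SConn E) (hcard : 3 ≤ Fintype.card V) :
    ∃ (c : List V) (vb wb : V), IsDirCycle E c ∧ vb ∈ c ∧ wb ∈ c ∧
      ¬ IsLeafVertex E vb ∧ ¬ IsLeafVertex E wb ∧
      (∀ u ∈ nbrFinset E vb, u ∈ c ∨ IsLeafVertex E u) ∧
      (∀ u ∈ nbrFinset E wb, u ∈ c ∨ IsLeafVertex E u) := by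
  have : Nontrivial V := Fintype.one_lt_card_iff_nontrivial.1 (by omega)
  obtain ⟨v, hv⟩ := hconn.exists_not_isLeafVertex hbi hcard
  obtain ⟨a, l, hnd, hch, hP, hmax⟩ :=
    exists_maximal_path (fun u w => (u, w) ∈ E) (fun u => ¬ IsLeafVertex E u) hv
  have ha : ¬ IsLeafVertex E a := hP a (by simp)
  suffices h : ∃ c : List V, IsDirCycle E c ∧ a ∈ c ∧
      ∀ u ∈ nbrFinset E a, u ∈ c ∨ IsLeafVertex E u by
    obtain ⟨c, hc, hac, hn⟩ := h
    exact ⟨c, a, a, hc, hac, hac, ha, ha, hn, hn⟩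
  have hmem : ∀ u, (a, u) ∈ E → ¬ IsLeafVertex E u → u ∈ l := by
    intro u hau hu
    rcases List.mem_cons.1 (hmax u hu (hbi _ hau)) with rfl | h
    · exact absurd rfl (hdig _ hau)
    · exact h
  by_cases hex : ∃ x ∈ l, (a, x) ∈ E
  · obtain ⟨l₁, x, l₂, rfl, hax, hl₂⟩ := List.exists_last_satisfying _ l hex
    have hsplit : a :: (l₁ ++ x :: l₂) = (a :: (l₁ ++ [x])) ++ l₂ := by simp
    rw [hsplit] at hnd hch
    refine ⟨a :: (l₁ ++ [x]), ⟨by simp, (List.nodup_append.1 hnd).1, ?_⟩, by simp, ?_⟩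
    · rw [List.rotate_cons_succ, List.rotate_zero]
      refine List.IsChain.rel_of_mem_zip (R := fun u w => (u, w) ∈ E) ?_
      have hxa : (x, a) ∈ E := hbi _ hax
      have hpre := (List.isChain_append.1 hch).1
      rw [← List.cons_append]
      refine List.isChain_append.2 ⟨hpre, by simp, ?_⟩
      intro y hy z hz
      rw [← List.cons_append, List.getLast?_concat] at hy
      simp only [List.head?_cons, Option.mem_def, Option.some.injEq] at hy hz
      subst hy hz
      exact hxa
    · intro u hu
      rw [mem_nbrFinset_iff hbi] at hu
      refine or_iff_not_imp_right.2 fun hleaf => ?_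
      have := hmem u hu hleaf
      have hn := fun h => hl₂ u h hu
      simp only [List.mem_append, List.mem_cons] at this ⊢
      tauto
  · obtain ⟨u, hu⟩ := hconn.exists_arc a
    refine ⟨[a, u], ⟨by simp, by simpa using hdig _ hu, ?_⟩, by simp, ?_⟩
    · have hua : (u, a) ∈ E := hbi _ hu
      simp [hu, hua]
    · intro w hw
      rw [mem_nbrFinset_iff hbi] at hw
      refine or_iff_not_imp_right.2 fun hleaf => ?_
      exact absurd ⟨w, hmem w hw hleaf, hw⟩ hex
end

section
/- Let (G = (V, E), 𝒞) be an instance of Star Strong Connectivity whose input digraph G is bidirected (uv ∈ E implies vu ∈ E) and with |V| ≥ 2. Then there exists a perfect set Q ⊆ 𝒞 together with two cuts S₁ ≠ S₂ that are both internal to Q and star-disjoint from each other. -/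
def cutStars {V : Type*} [DecidableEq V] (𝒞 : Finset (Finset (V × V))) (S : Finset V) :
    Finset (Finset (V × V)) :=
  𝒞.filter (fun F => (∃ a ∈ F, a.1 ∈ S) ∧ (∃ a ∈ F, a.2 ∉ S))

def InternalCut {V : Type*} [Fintype V] [DecidableEq V]
    (𝒞 Q : Finset (Finset (V × V))) (S : Finset V) : Prop :=
  S.Nonempty ∧ S ≠ Finset.univ ∧
  ∀ F ∈ cutStars 𝒞 S, (∀ a ∈ F, a.1 ∈ srcSet Q) ∧ (∀ a ∈ F, a.2 ∈ srcSet Q)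

/-- `x` and `y` are joined by an arc of some star of `𝒞`. -/
def StarAdj {V : Type*} (𝒞 : Finset (Finset (V × V))) (x y : V) : Prop :=
  ∃ F ∈ 𝒞, (x, y) ∈ F

/-- `f` assigns to every vertex of `X` a star of `𝒞` with that source, and the chosen arcs with both
endpoints in `X` form a strongly connected digraph on `X`. -/
def StarChoice {V : Type*} (𝒞 : Finset (Finset (V × V))) (X : Finset V)
    (f : V → Finset (V × V)) : Prop :=
  (∀ x ∈ X, f x ∈ 𝒞 ∧ ∀ a ∈ f x, a.1 = x) ∧
  ∀ u ∈ X, ∀ v ∈ X, Relation.ReflTransGen (fun x y => x ∈ X ∧ y ∈ X ∧ (x, y) ∈ f x) u v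

/-- A path in the graph underlying `𝒞`, as a list of vertices. -/
def IsStarPath {V : Type*} (𝒞 : Finset (Finset (V × V))) (l : List V) : Prop :=
  l.Nodup ∧ l.IsChain (StarAdj 𝒞)

section Helpers

variable {V : Type*} {𝒞 : Finset (Finset (V × V))}

lemma IsStar.fst_eq {F : Finset (V × V)} (hF : IsStar F) {x y : V} (h : (x, y) ∈ F) :
    ∀ a ∈ F, a.1 = x :=
  fun a ha => hF.2.1 a ha _ h

lemma exists_maximal_of_bdd {α : Type*} {p : α → Prop} (f : α → ℕ) (n : ℕ)
    (hb : ∀ a, p a → f a ≤ n) (hne : ∃ a, p a) : ∃ a, p a ∧ ∀ b, p b → f b ≤ f a := by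
  by_contra! hcon
  obtain ⟨a, ha⟩ := hne
  have key : ∀ k, ∃ a, p a ∧ k ≤ f a := by
    intro k
    induction k with
    | zero => exact ⟨a, ha, Nat.zero_le _⟩
    | succ k ih =>
      obtain ⟨b, hb, hk⟩ := ih
      obtain ⟨c, hc, hlt⟩ := hcon b hb
      exact ⟨c, hc, by omega⟩
  obtain ⟨b, hpb, hk⟩ := key (n + 1)
  have := hb b hpb
  omega

/-- A strongly connected choice of stars extends to one whose stars have all sinks inside. -/
lemma StarChoice.exists_closed [Fintype V] [DecidableEq V] (hstar : ∀ F ∈ 𝒞, IsStar F)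
    (hsymm : ∀ x y, StarAdj 𝒞 x y → StarAdj 𝒞 y x) {X : Finset V} {f : V → Finset (V × V)}
    (h : StarChoice 𝒞 X f) :
    ∃ X' f', X ⊆ X' ∧ StarChoice 𝒞 X' f' ∧ (∀ x ∈ X, f' x = f x) ∧
      ∀ x ∈ X', ∀ a ∈ f' x, a.2 ∈ X' := by
  induction hn : Xᶜ.card using Nat.strong_induction_on generalizing X f with
  | _ n ih =>
  by_cases hcl : ∀ x ∈ X, ∀ a ∈ f x, a.2 ∈ X
  · exact ⟨X, f, subset_rfl, h, fun _ _ => rfl, hcl⟩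
  push Not at hcl
  obtain ⟨x, hx, ⟨x', w⟩, ha, hw⟩ := hcl
  obtain rfl : x' = x := (h.1 x hx).2 _ ha
  simp only at hw
  obtain ⟨G, hG, hwG⟩ := hsymm x' w ⟨_, (h.1 x' hx).1, ha⟩
  have hf : ∀ z ∈ X, Function.update f w G z = f z := fun z hz =>
    Function.update_of_ne (by rintro rfl; exact hw hz) _ _
  have hmono : ∀ u ∈ X, ∀ v ∈ X, Relation.ReflTransGen
      (fun a b => a ∈ insert w X ∧ b ∈ insert w X ∧ (a, b) ∈ Function.update f w G a) u v := by
    intro u hu v hv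
    refine Relation.ReflTransGen.mono ?_ _ _ (h.2 u hu v hv)
    rintro a b ⟨h1, h2, h3⟩
    exact ⟨Finset.mem_insert_of_mem h1, Finset.mem_insert_of_mem h2, by rwa [hf a h1]⟩
  have hchoice : StarChoice 𝒞 (insert w X) (Function.update f w G) := by
    refine ⟨fun z hz => ?_, fun u hu v hv => ?_⟩
    · rcases Finset.mem_insert.1 hz with rfl | hz
      · simpa using ⟨hG, fun a b hab => (hstar G hG).fst_eq hwG _ hab⟩
      · rw [hf z hz]
        exact h.1 z hz
    · refine Relation.ReflTransGen.trans (b := x') ?_ ?_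
      · rcases Finset.mem_insert.1 hu with rfl | hu
        · exact .single ⟨hu, Finset.mem_insert_of_mem hx, by simpa using hwG⟩
        · exact hmono u hu x' hx
      · rcases Finset.mem_insert.1 hv with rfl | hv
        · exact .single ⟨Finset.mem_insert_of_mem hx, hv, by rwa [hf x' hx]⟩
        · exact hmono x' hx v hv
  have hlt : (insert w X)ᶜ.card < n := by
    rw [← hn]
    refine Finset.card_lt_card ⟨Finset.compl_subset_compl.2 (Finset.subset_insert _ _), fun hs => ?_⟩
    have := hs (Finset.mem_compl.2 hw)
    simp at this
  obtain ⟨X', f', h1, h2, h3, h4⟩ := ih _ hlt hchoice rfl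
  exact ⟨X', f', (Finset.subset_insert _ _).trans h1, h2,
    fun z hz => (h3 z (Finset.mem_insert_of_mem hz)).trans (hf z hz), h4⟩

/-- Along a path one can choose stars whose arcs traverse the path towards its head. -/
lemma IsStarPath.exists_stars [DecidableEq V] (hstar : ∀ F ∈ 𝒞, IsStar F)
    (hsymm : ∀ x y, StarAdj 𝒞 x y → StarAdj 𝒞 y x) {l : List V} {a : V}
    (hl : IsStarPath 𝒞 (a :: l)) {F : Finset (V × V)} (hF : F ∈ 𝒞) (ha : ∀ b ∈ F, b.1 = a) :
    ∃ f : V → Finset (V × V), f a = F ∧ (∀ x ∈ a :: l, f x ∈ 𝒞 ∧ ∀ b ∈ f x, b.1 = x) ∧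
      (a :: l).IsChain (fun x y => (y, x) ∈ f y) := by
  induction l generalizing a F with
  | nil => exact ⟨fun _ => F, rfl, by simpa using ⟨hF, by simpa using ha⟩, by simp⟩
  | cons b l ih =>
    obtain ⟨hnd, hch⟩ := hl
    rw [List.isChain_cons_cons] at hch
    rw [List.nodup_cons] at hnd
    obtain ⟨G, hG, hbG⟩ := hsymm _ _ hch.1
    obtain ⟨f, hfb, hf, hfc⟩ := ih ⟨hnd.2, hch.2⟩ hG ((hstar G hG).fst_eq hbG)
    have hup : ∀ x ∈ b :: l, Function.update f a F x = f x := fun x hx =>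
      Function.update_of_ne (by rintro rfl; exact hnd.1 hx) _ _
    refine ⟨Function.update f a F, by simp, fun x hx => ?_, ?_⟩
    · rcases List.mem_cons.1 hx with rfl | hx
      · simpa using ⟨hF, by simpa using ha⟩
      · rw [hup x hx]
        exact hf x hx
    · rw [List.isChain_cons_cons]
      refine ⟨by rw [hup b (by simp), hfb]; exact hbG, hfc.imp_of_mem_imp ?_⟩
      intro x y _ hy hxy
      rwa [hup y hy]

lemma List.IsChain.reflTransGen_flip {R : V → V → Prop} {l : List V} {a : V}
    (h : (a :: l).IsChain (fun x y => R y x)) {x : V} (hx : x ∈ a :: l) :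
    Relation.ReflTransGen R x a ∧
      Relation.ReflTransGen R ((a :: l).getLast (by simp)) x := by
  induction l generalizing a x with
  | nil =>
    obtain rfl : x = a := by simpa using hx
    exact ⟨.refl, .refl⟩
  | cons b l ih =>
    rw [List.isChain_cons_cons] at h
    rw [List.getLast_cons (by simp)]
    rcases List.mem_cons.1 hx with rfl | hx
    · exact ⟨.refl, (ih h.2 (x := b) (by simp)).2.tail h.1⟩
    · exact ⟨(ih h.2 hx).1.tail h.1, (ih h.2 hx).2⟩

/-- A path whose head has a star reaching its last vertex supports a strongly connected choice. -/
lemma IsStarPath.exists_closed_starChoice [Fintype V] [DecidableEq V] (hstar : ∀ F ∈ 𝒞, IsStar F)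
    (hsymm : ∀ x y, StarAdj 𝒞 x y → StarAdj 𝒞 y x) {l : List V} {a : V}
    (hl : IsStarPath 𝒞 (a :: l)) {F : Finset (V × V)} (hF : F ∈ 𝒞) (ha : ∀ b ∈ F, b.1 = a)
    (hlast : ∀ z ∈ l.getLast?, (a, z) ∈ F) :
    ∃ X f, StarChoice 𝒞 X f ∧ (∀ x ∈ X, ∀ b ∈ f x, b.2 ∈ X) ∧ (∀ x ∈ a :: l, x ∈ X) ∧
      ∀ b ∈ F, b.2 ∈ X := by
  obtain ⟨f, hfa, hf, hfc⟩ := hl.exists_stars hstar hsymm hF ha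
  have hc : StarChoice 𝒞 (a :: l).toFinset f := by
    refine ⟨fun x hx => hf x (List.mem_toFinset.1 hx), fun u hu v hv => ?_⟩
    have hch : (a :: l).IsChain (fun x y => (fun p q => p ∈ (a :: l).toFinset ∧
        q ∈ (a :: l).toFinset ∧ (p, q) ∈ f p) y x) :=
      hfc.imp_of_mem_imp fun x y hx hy h => ⟨List.mem_toFinset.2 hy, List.mem_toFinset.2 hx, h⟩
    refine (hch.reflTransGen_flip (List.mem_toFinset.1 hu)).1.trans
      (Relation.ReflTransGen.trans ?_ (hch.reflTransGen_flip (List.mem_toFinset.1 hv)).2)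
    rcases l.eq_nil_or_concat with rfl | ⟨l', z, rfl⟩
    · exact .refl
    · refine .single ⟨by simp, List.mem_toFinset.2 (List.getLast_mem _), ?_⟩
      rw [hfa]
      exact hlast _ (by simp)
  obtain ⟨X, f', hX, hc', hff, hcl⟩ := hc.exists_closed hstar hsymm
  have haX : a ∈ X := hX (by simp)
  refine ⟨X, f', hc', hcl, fun x hx => hX (List.mem_toFinset.2 hx), ?_⟩
  rw [← hfa, ← hff a (by simp)]
  exact hcl a haX

lemma StarChoice.srcSet_image [DecidableEq V] (hstar : ∀ F ∈ 𝒞, IsStar F) {X : Finset V}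
    {f : V → Finset (V × V)} (h : StarChoice 𝒞 X f) : srcSet (X.image f) = X := by
  ext x
  simp only [srcSet, Finset.mem_biUnion, Finset.mem_image]
  constructor
  · rintro ⟨_, ⟨z, hz, rfl⟩, a, ha, rfl⟩
    rwa [(h.1 z hz).2 a ha]
  · intro hx
    obtain ⟨a, ha⟩ := (hstar _ (h.1 x hx).1).1
    exact ⟨_, ⟨x, hx, rfl⟩, a, ha, (h.1 x hx).2 a ha⟩

lemma StarChoice.perfectSet_image [DecidableEq V] (hstar : ∀ F ∈ 𝒞, IsStar F) {X : Finset V}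
    {f : V → Finset (V × V)} (h : StarChoice 𝒞 X f) (hcl : ∀ x ∈ X, ∀ b ∈ f x, b.2 ∈ X) :
    PerfectSet (X.image f) := by
  refine ⟨⟨?_, ?_⟩, ?_⟩
  · simp only [Finset.mem_image]
    rintro _ ⟨x, hx, rfl⟩ _ ⟨y, hy, rfl⟩ hne a ha b hb hab
    rw [(h.1 x hx).2 a ha, (h.1 y hy).2 b hb] at hab
    exact hne (by rw [hab])
  · rw [h.srcSet_image hstar]
    intro u hu v hv
    refine Relation.ReflTransGen.mono ?_ _ _ (h.2 u hu v hv)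
    rintro a b ⟨h1, h2, h3⟩
    exact ⟨h1, h2, Finset.mem_biUnion.2 ⟨_, Finset.mem_image_of_mem f h1, h3⟩⟩
  · rw [h.srcSet_image hstar]
    simp only [Finset.mem_image]
    rintro _ ⟨x, hx, rfl⟩
    exact hcl x hx

/-- A vertex whose closed neighbourhood consists of sources of `Q` is an internal cut. -/
lemma internalCut_singleton [Fintype V] [DecidableEq V] (hcard : 2 ≤ Fintype.card V)
    (hstar : ∀ F ∈ 𝒞, IsStar F) {Q : Finset (Finset (V × V))} {v : V} (hv : v ∈ srcSet Q)
    (hN : ∀ u, StarAdj 𝒞 v u → u ∈ srcSet Q) : InternalCut 𝒞 Q {v} := by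
  refine ⟨Finset.singleton_nonempty v, fun h => ?_, fun F hF => ?_⟩
  · have := congrArg Finset.card h
    rw [Finset.card_singleton, Finset.card_univ] at this
    omega
  · simp only [cutStars, Finset.mem_filter, Finset.mem_singleton] at hF
    obtain ⟨hF, ⟨b, hb, hbv⟩, -⟩ := hF
    have hsrc : ∀ a ∈ F, a.1 = v := fun a ha => ((hstar F hF).2.1 a ha b hb).trans hbv
    exact ⟨fun a ha => hsrc a ha ▸ hv, fun a ha => hN _ ⟨F, hF, by rw [← hsrc a ha]; exact ha⟩⟩

lemma cutStars_singleton_inter [DecidableEq V] (hstar : ∀ F ∈ 𝒞, IsStar F) {v : V}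
    {S : Finset V} (hv : v ∉ S) : cutStars 𝒞 {v} ∩ cutStars 𝒞 S = ∅ := by
  refine Finset.eq_empty_of_forall_notMem fun F hF => ?_
  simp only [cutStars, Finset.mem_inter, Finset.mem_filter, Finset.mem_singleton] at hF
  obtain ⟨⟨hF, ⟨a, ha, hav⟩, -⟩, -, ⟨b, hb, hbS⟩, -⟩ := hF
  rw [(hstar F hF).2.1 b hb a ha, hav] at hbS
  exact hv hbS

/-- In a longest path, split so that the initial segment before a neighbour of the head is as long
as possible, all neighbours of the head lie in that segment or are its successor. -/
lemma neighbor_mem_of_longest (hsymm : ∀ x y, StarAdj 𝒞 x y → StarAdj 𝒞 y x) {m n : ℕ}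
    (hm : ∀ l, IsStarPath 𝒞 l → l.length ≤ m)
    (hn : ∀ v (A : List V) w t, IsStarPath 𝒞 (v :: A ++ w :: t) → (v :: A ++ w :: t).length = m →
      StarAdj 𝒞 v w → A.length ≤ n)
    {v w : V} {A t : List V} (hp : IsStarPath 𝒞 (v :: A ++ w :: t))
    (hlen : (v :: A ++ w :: t).length = m) (hA : A.length = n) {u : V} (hu : StarAdj 𝒞 v u) :
    u ∈ v :: A ++ [w] := by
  by_contra hcon
  by_cases hut : u ∈ t
  · obtain ⟨t₁, t₂, rfl⟩ := List.append_of_mem hut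
    have := hn v (A ++ w :: t₁) u t₂ (by simpa using hp) (by simpa using hlen) hu
    simp at this
    omega
  · have := hm (u :: (v :: A ++ w :: t)) ⟨List.nodup_cons.2 ⟨?_, hp.1⟩,
      List.isChain_cons_cons.2 ⟨hsymm _ _ hu, hp.2⟩⟩
    · simp at this hlen
      omega
    · simp at hcon ⊢
      tauto

end Helpers

theorem stmt6 {V : Type*} [Fintype V] [DecidableEq V]
    (E : Finset (V × V)) (𝒞 : Finset (Finset (V × V)))
    (hcard : 2 ≤ Fintype.card V)
    (hdig : IsDigraph E) (hbi : ∀ a ∈ E, (a.2, a.1) ∈ E) (hconn : SConn E)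
    (hstar : ∀ F ∈ 𝒞, IsStar F) (hcover : 𝒞.biUnion id = E) :
    ∃ Q ⊆ 𝒞, PerfectSet Q ∧ ∃ S₁ S₂ : Finset V, S₁ ≠ S₂ ∧
      InternalCut 𝒞 Q S₁ ∧ InternalCut 𝒞 Q S₂ ∧
      cutStars 𝒞 S₁ ∩ cutStars 𝒞 S₂ = ∅ := by
  have hadj : ∀ x y, StarAdj 𝒞 x y ↔ (x, y) ∈ E := by
    intro x y
    rw [← hcover]
    simp [StarAdj]
  have hsymm : ∀ x y, StarAdj 𝒞 x y → StarAdj 𝒞 y x := by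
    intro x y
    rw [hadj, hadj]
    exact hbi (x, y)
  have hirr : ∀ x, ¬ StarAdj 𝒞 x x := fun x h => hdig _ ((hadj x x).1 h) rfl
  have finish : ∀ X f, StarChoice 𝒞 X f → (∀ x ∈ X, ∀ b ∈ f x, b.2 ∈ X) →
      ∀ S₁ S₂ : Finset V, S₁ ≠ S₂ → (srcSet (X.image f) = X → InternalCut 𝒞 (X.image f) S₁) →
      (srcSet (X.image f) = X → InternalCut 𝒞 (X.image f) S₂) →
      cutStars 𝒞 S₁ ∩ cutStars 𝒞 S₂ = ∅ →
      ∃ Q ⊆ 𝒞, PerfectSet Q ∧ ∃ S₁ S₂ : Finset V, S₁ ≠ S₂ ∧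
        InternalCut 𝒞 Q S₁ ∧ InternalCut 𝒞 Q S₂ ∧ cutStars 𝒞 S₁ ∩ cutStars 𝒞 S₂ = ∅ := by
    intro X f hc hcl S₁ S₂ hne h₁ h₂ hd
    have hs := hc.srcSet_image hstar
    refine ⟨X.image f, ?_, hc.perfectSet_image hstar hcl, S₁, S₂, hne, h₁ hs, h₂ hs, hd⟩
    exact Finset.image_subset_iff.2 fun x hx => (hc.1 x hx).1
  have pair : ∀ X f, StarChoice 𝒞 X f → (∀ x ∈ X, ∀ b ∈ f x, b.2 ∈ X) →
      ∀ v z, v ≠ z → v ∈ X → z ∈ X → (∀ u, StarAdj 𝒞 v u → u ∈ X) →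
      (∀ u, StarAdj 𝒞 z u → u ∈ X) →
      ∃ Q ⊆ 𝒞, PerfectSet Q ∧ ∃ S₁ S₂ : Finset V, S₁ ≠ S₂ ∧
        InternalCut 𝒞 Q S₁ ∧ InternalCut 𝒞 Q S₂ ∧ cutStars 𝒞 S₁ ∩ cutStars 𝒞 S₂ = ∅ := by
    intro X f hc hcl v z hne hv hz hNv hNz
    refine finish X f hc hcl {v} {z} (by simpa using hne) ?_ ?_
      (cutStars_singleton_inter hstar (by simpa using hne))
    · intro hs
      exact internalCut_singleton hcard hstar (by rwa [hs]) (by rwa [hs])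
    · intro hs
      exact internalCut_singleton hcard hstar (by rwa [hs]) (by rwa [hs])
  obtain ⟨p, hp, hpmax⟩ := exists_maximal_of_bdd (p := IsStarPath 𝒞) List.length (Fintype.card V)
    (fun l hl => hl.1.length_le_card) ⟨[], List.nodup_nil, List.isChain_nil⟩
  have hlen2 : 2 ≤ p.length := by
    obtain ⟨x, y, hxy⟩ := Fintype.exists_pair_of_one_lt_card (show 1 < Fintype.card V by omega)
    rcases Relation.ReflTransGen.cases_head (hconn x y) with h | ⟨z, hz, -⟩
    · exact absurd h hxy
    · have hz := (hadj x z).2 hz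
      refine hpmax [x, z] ⟨?_, ?_⟩
      · simp only [List.nodup_cons, List.mem_singleton, List.not_mem_nil, not_false_eq_true,
          List.nodup_nil, and_true]
        rintro rfl
        exact hirr _ hz
      · simpa using hz
  obtain ⟨⟨v, A, w, t⟩, ⟨hP, hPlen, hvw⟩, hAmax⟩ := exists_maximal_of_bdd
    (p := fun q : V × List V × V × List V => IsStarPath 𝒞 (q.1 :: q.2.1 ++ q.2.2.1 :: q.2.2.2) ∧
      (q.1 :: q.2.1 ++ q.2.2.1 :: q.2.2.2).length = p.length ∧ StarAdj 𝒞 q.1 q.2.2.1)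
    (fun q => q.2.1.length) p.length
    (by
      rintro ⟨v, A, w, t⟩ ⟨-, h, -⟩
      simp at h ⊢
      omega)
    (by
      match p, hp, hlen2 with
      | v :: w :: t, hp, _ =>
        exact ⟨(v, [], w, t), by simpa using hp, by simp, (List.isChain_cons_cons.1 hp.2).1⟩)
  simp only at hP hPlen hvw hAmax
  have hmax : ∀ v (A' : List V) w t, IsStarPath 𝒞 (v :: A' ++ w :: t) →
      (v :: A' ++ w :: t).length = p.length → StarAdj 𝒞 v w → A'.length ≤ A.length :=
    fun v A' w t h1 h2 h3 => hAmax (v, A', w, t) ⟨h1, h2, h3⟩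
  have hNv := fun u => neighbor_mem_of_longest hsymm hpmax hmax hP hPlen rfl (u := u)
  rcases A.eq_nil_or_concat with rfl | ⟨q, z, rfl⟩
  · -- the end `v` of the path is a leaf with neighbour `w`
    have hNv' : ∀ u, StarAdj 𝒞 v u → u = w := by
      intro u hu
      have := hNv u hu
      simp at this
      rcases this with rfl | h
      · exact absurd hu (hirr _)
      · exact h
    by_cases hother : ∃ G ∈ 𝒞, (w, v) ∈ G ∧ ∃ u, (w, u) ∈ G ∧ u ≠ v ∧ u ∉ t
    · obtain ⟨G, hG, hwv, u, hwu, huv, hut⟩ := hother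
      have huw : u ≠ w := by
        rintro rfl
        exact hirr _ ⟨G, hG, hwu⟩
      have hP' : IsStarPath 𝒞 (u :: [] ++ w :: t) := by
        simp only [IsStarPath, List.cons_append, List.nil_append, List.nodup_cons,
          List.isChain_cons_cons, List.mem_cons] at hP ⊢
        exact ⟨⟨by tauto, hP.1.2⟩, hsymm _ _ ⟨G, hG, hwu⟩, hP.2.2⟩
      have hNu := fun x => neighbor_mem_of_longest hsymm hpmax hmax hP'
        (by simpa using hPlen) rfl (u := x)
      have hpath : IsStarPath 𝒞 [w] := ⟨by simp, by simp⟩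
      obtain ⟨X, f, hc, hcl, hX, hGX⟩ := hpath.exists_closed_starChoice hstar hsymm hG
        ((hstar G hG).fst_eq hwv) (by simp)
      have hvX : v ∈ X := hGX _ hwv
      have huX : u ∈ X := hGX _ hwu
      have hwX : w ∈ X := hX w (by simp)
      refine pair X f hc hcl v u huv.symm hvX huX (fun x hx => hNv' x hx ▸ hwX) fun x hx => ?_
      have := hNu x hx
      simp at this
      rcases this with rfl | rfl <;> assumption
    · push Not at hother
      obtain ⟨F₀, hF₀, hwvF₀⟩ := hsymm _ _ hvw
      obtain ⟨⟨l, G⟩, ⟨⟨t₂, ht⟩, hG, hwv, hlast⟩, hlmax⟩ := exists_maximal_of_bdd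
        (p := fun q : List V × Finset (V × V) => q.1 <+: t ∧ q.2 ∈ 𝒞 ∧ (w, v) ∈ q.2 ∧
          ∀ z ∈ q.1.getLast?, (w, z) ∈ q.2)
        (fun q => q.1.length) t.length (fun q hq => hq.1.length_le)
        ⟨([], F₀), List.nil_prefix, hF₀, hwvF₀, by simp⟩
      simp only at ht hG hwv hlast hlmax
      subst ht
      have hpath : IsStarPath 𝒞 (w :: l) := by
        have h1 : List.Nodup (v :: ((w :: l) ++ t₂)) := by simpa using hP.1
        have h2 : List.IsChain (StarAdj 𝒞) (v :: ((w :: l) ++ t₂)) := by simpa using hP.2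
        exact ⟨(List.nodup_cons.1 h1).2.of_append_left, h2.tail.left_of_append⟩
      obtain ⟨X, f, hc, hcl, hX, hGX⟩ := hpath.exists_closed_starChoice hstar hsymm hG
        ((hstar G hG).fst_eq hwv) hlast
      have hvX : v ∈ X := hGX _ hwv
      have hwX : w ∈ X := hX w (by simp)
      have hvw' : w ≠ v := by
        rintro rfl
        exact hirr _ hvw
      refine finish X f hc hcl {v} (Finset.univ.erase v) ?_ ?_ ?_
        (cutStars_singleton_inter hstar (by simp))
      · intro h
        exact Finset.notMem_erase v Finset.univ (by rw [← h]; exact Finset.mem_singleton_self v)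
      · intro hs
        exact internalCut_singleton hcard hstar (by rwa [hs]) fun x hx => by
          rw [hs, hNv' x hx]
          exact hwX
      · intro hs
        refine ⟨⟨w, by simpa using hvw'⟩, ?_, fun F hF => ?_⟩
        · intro h
          exact Finset.notMem_erase v Finset.univ (by rw [h]; exact Finset.mem_univ v)
        · simp only [cutStars, Finset.mem_filter, Finset.mem_erase, Finset.mem_univ, and_true,
            not_not] at hF
          obtain ⟨hF, -, ⟨b, b'⟩, hb, rfl⟩ := hF
          obtain rfl : b = w := hNv' b (hsymm _ _ ⟨F, hF, hb⟩)
          have hsrc := (hstar F hF).fst_eq hb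
          rw [hs]
          refine ⟨fun a ha => hsrc a ha ▸ hwX, ?_⟩
          rintro ⟨a, u⟩ ha
          obtain rfl : a = b := hsrc _ ha
          simp only
          by_cases huv : u = b'
          · exact huv ▸ hvX
          by_cases hul : u ∈ l
          · exact hX u (List.mem_cons_of_mem _ hul)
          exfalso
          have hut := hother F hF hb u ha huv
          have hut₂ : u ∈ t₂ := (List.mem_append.1 hut).resolve_left hul
          obtain ⟨s₁, s₂, rfl⟩ := List.append_of_mem hut₂
          have := hlmax (l ++ s₁ ++ [u], F) ⟨⟨s₂, by simp⟩, hF, hb, by simpa using ha⟩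
          simp at this
  · -- rotating the path makes `z` an end of a longest path as well
    simp only [List.concat_eq_append] at *
    have hrot : IsStarPath 𝒞 (z :: (q.reverse ++ [v]) ++ w :: t) := by
      have e : z :: (q.reverse ++ [v]) ++ w :: t = (v :: (q ++ [z])).reverse ++ w :: t := by simp
      rw [e]
      refine ⟨?_, ?_⟩
      · exact (((List.reverse_perm _).append_right _).nodup_iff).2 hP.1
      · have h := List.isChain_append.1 hP.2
        refine (List.isChain_reverse.2 (h.1.imp fun _ _ => hsymm _ _)).append h.2.1 ?_
        rw [List.getLast?_reverse]
        simpa using hvw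
    have hNz := fun u => neighbor_mem_of_longest hsymm hpmax hmax hrot
      (by simp at hPlen ⊢; omega) (by simp) (u := u)
    obtain ⟨F, hF, hvF⟩ := hvw
    have hpath : IsStarPath 𝒞 (v :: (q ++ [z] ++ [w])) := by
      have h1 : List.Nodup ((v :: (q ++ [z] ++ [w])) ++ t) := by simpa using hP.1
      have h2 : List.IsChain (StarAdj 𝒞) ((v :: (q ++ [z] ++ [w])) ++ t) := by simpa using hP.2
      exact ⟨h1.of_append_left, h2.left_of_append⟩
    obtain ⟨X, f, hc, hcl, hX, -⟩ := hpath.exists_closed_starChoice hstar hsymm hF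
      ((hstar F hF).fst_eq hvF) (by simpa using hvF)
    refine pair X f hc hcl v z ?_ (hX v (by simp)) (hX z (by simp)) (fun u hu => hX u ?_)
      fun u hu => hX u ?_
    · rintro rfl
      have := hP.1
      simp at this
    · have := hNv u hu
      simp at this ⊢
      tauto
    · have := hNz u hu
      simp at this ⊢
      tauto
end

section
/- Let (G = (V, E), 𝒞) be an instance of Star Strong Connectivity with |V| ≥ 2. Then there exists a feasible set R ⊆ 𝒞 such that for every function x : 𝒞 → ℝ with x_F ≥ 0 for all F ∈ 𝒞 and Σ_{F∈∂𝒞(S)} x_F ≥ 1 for every cut ∅ ⊂ S ⊂ V, one has |R| ≤ (8/5)·Σ_{F∈𝒞} x_F. In particular, the integrality gap of the standard cut-based linear program for Star Strong Connectivity is at most 1.6. -/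
namespace StarStrongConnectivity

/-- A family of stars: every index `t` has a source and a set of sinks. -/
structure StarSystem (W ι : Type*) where
  source : ι → W
  sinks : ι → Set W

namespace StarSystem

open Relation Set

variable {W ι : Type*} (G : StarSystem W ι)

def Crosses (S : Set W) (t : ι) : Prop :=
  G.source t ∈ S ∧ ∃ v ∈ G.sinks t, v ∉ S

def Inside (Q : Set W) (t : ι) : Prop :=
  G.source t ∈ Q ∧ G.sinks t ⊆ Q

def Connected (R : Set ι) : Prop :=
  ∀ S : Set W, S.Nonempty → S ≠ univ → ∃ t ∈ R, G.Crosses S t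

def Arc (u v : W) : Prop :=
  u ≠ v ∧ ∃ t, G.source t = u ∧ v ∈ G.sinks t

/-- A fractional solution of the cut-based linear program. -/
structure IsFractional [Fintype ι] (x : ι → ℝ) : Prop where
  nonneg : ∀ t, 0 ≤ x t
  cut : ∀ S : Set W, S.Nonempty → S ≠ univ → 1 ≤ ∑ t, {t | G.Crosses S t}.indicator x t

/-- The choice `f` of one star per vertex leads from every vertex to the root `s`. -/
structure IsRooted (f : W → ι) (s : W) : Prop where
  source : ∀ w, G.source (f w) = w
  reach : ∀ w, ReflTransGen (fun a b => b ∈ G.sinks (f a)) w s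

/-- The vertices reachable from `s` along the stars chosen by `f`. -/
def reachSet (f : W → ι) (s : W) : Set W :=
  {w | ReflTransGen (fun a b => b ∈ G.sinks (f a)) s w}

/-- A simple path, listed from its end vertex back to its start vertex. -/
structure IsRevPath (l : List W) : Prop where
  nodup : l.Nodup
  chain : l.IsChain (fun a b => G.Arc b a)

variable {G}

lemma exists_cut_edge {r : W → W → Prop} {a b : W} (h : ReflTransGen r a b) {S : Set W}
    (ha : a ∈ S) (hb : b ∉ S) : ∃ u v, ReflTransGen r a u ∧ r u v ∧ u ∈ S ∧ v ∉ S := by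
  induction h with
  | refl => exact absurd ha hb
  | @tail c d hac hcd ih =>
    by_cases hc : c ∈ S
    · exact ⟨c, d, hac, hcd, hc, hb⟩
    · exact ih hc

lemma exists_rooted_extension [Finite W] (hG : G.Connected univ) {s : W} (n : ℕ) :
    ∀ (X : Set W) (f : W → ι), Xᶜ.ncard = n → s ∈ X → (∀ w ∈ X, G.source (f w) = w) →
      (∀ w ∈ X, ReflTransGen (fun a b => a ∈ X ∧ b ∈ G.sinks (f a)) w s) →
      ∃ f', EqOn f' f X ∧ G.IsRooted f' s := by
  classical
  induction n with
  | zero =>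
    intro X f hn hs hsrc hreach
    have hX : X = univ := by
      rw [Set.ncard_eq_zero] at hn
      simpa using hn
    subst hX
    exact ⟨f, fun _ _ => rfl, fun w => hsrc w trivial,
      fun w => ReflTransGen.mono (fun _ _ h => h.2) _ _ (hreach w trivial)⟩
  | succ n ih =>
    intro X f hn hs hsrc hreach
    have hne : Xᶜ.Nonempty := by
      rw [← Set.ncard_pos, hn]; omega
    obtain ⟨t, -, ht, v, hv, hvX⟩ := hG Xᶜ hne (fun h => by
      have : s ∈ Xᶜ := h ▸ trivial
      exact this hs)
    have hvX' : v ∈ X := by simpa using hvX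
    have hupd : ∀ w ∈ X, Function.update f (G.source t) t w = f w := by
      intro w hw
      exact Function.update_of_ne (by rintro rfl; exact ht hw) _ _
    have hold : ∀ w ∈ X, ReflTransGen (fun a b => a ∈ insert (G.source t) X ∧
        b ∈ G.sinks (Function.update f (G.source t) t a)) w s := by
      intro w hw
      refine ReflTransGen.mono (fun a b h => ⟨Or.inr h.1, ?_⟩) _ _ (hreach w hw)
      rw [hupd a h.1]; exact h.2
    obtain ⟨f', hf', hr⟩ := ih (insert (G.source t) X) (Function.update f (G.source t) t)
      (by
        have h1 : (insert (G.source t) X)ᶜ = Xᶜ \ {G.source t} := by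
          ext w; simp [not_or, and_comm]
        rw [h1, Set.ncard_sdiff_singleton_of_mem ht, hn]; rfl)
      (Or.inr hs)
      (by
        rintro w (rfl | hw)
        · simp
        · rw [hupd w hw]; exact hsrc w hw)
      (by
        rintro w (rfl | hw)
        · exact ReflTransGen.head ⟨Or.inl rfl, by simpa using hv⟩ (hold v hvX')
        · exact hold w hw)
    exact ⟨f', fun w hw => (hf' (Or.inr hw)).trans (hupd w hw), hr⟩

lemma exists_rooted_of_chain [Finite W] (hG : G.Connected univ) {s : W} (l : List W) :
    ∀ (a : W) (X : Set W) (f : W → ι), a ∈ X → s ∈ X → (∀ w ∈ X, G.source (f w) = w) →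
      (∀ w ∈ X, ReflTransGen (fun a b => a ∈ X ∧ b ∈ G.sinks (f a)) w s) →
      l.Nodup → (∀ w ∈ l, w ∉ X) → (a :: l).IsChain (fun a b => G.Arc b a) →
      ∃ f', EqOn f' f X ∧ G.IsRooted f' s ∧
        ∀ w ∈ a :: l, w ∈ G.reachSet f' ((a :: l).getLast (by simp)) := by
  classical
  induction l with
  | nil =>
    intro a X f ha hs hsrc hreach _ _ _
    obtain ⟨f', hf', hr⟩ := exists_rooted_extension hG _ X f rfl hs hsrc hreach
    refine ⟨f', hf', hr, fun w hw => ?_⟩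
    obtain rfl : w = a := by simpa using hw
    exact ReflTransGen.refl
  | cons b l ih =>
    intro a X f ha hs hsrc hreach hnd hdis hch
    rw [List.isChain_cons_cons] at hch
    obtain ⟨⟨-, t, rfl, hat⟩, hch'⟩ := hch
    have hbX : G.source t ∉ X := hdis _ (by simp)
    have hupd : ∀ w ∈ X, Function.update f (G.source t) t w = f w := by
      intro w hw
      exact Function.update_of_ne (by rintro rfl; exact hbX hw) _ _
    have hold : ∀ w ∈ X, ReflTransGen (fun a b => a ∈ insert (G.source t) X ∧
        b ∈ G.sinks (Function.update f (G.source t) t a)) w s := by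
      intro w hw
      refine ReflTransGen.mono (fun a b h => ⟨Or.inr h.1, ?_⟩) _ _ (hreach w hw)
      rw [hupd a h.1]; exact h.2
    rw [List.nodup_cons] at hnd
    obtain ⟨f', hf', hr, hl⟩ := ih (G.source t) (insert (G.source t) X)
      (Function.update f (G.source t) t) (Or.inl rfl) (Or.inr hs)
      (by
        rintro w (rfl | hw)
        · simp
        · rw [hupd w hw]; exact hsrc w hw)
      (by
        rintro w (rfl | hw)
        · exact ReflTransGen.head ⟨Or.inl rfl, by simpa using hat⟩ (hold a ha)
        · exact hold w hw)
      hnd.2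
      (by
        rintro w hw (rfl | hwX)
        · exact hnd.1 hw
        · exact hdis w (by simp [hw]) hwX)
      hch'
    refine ⟨f', fun w hw => (hf' (Or.inr hw)).trans (hupd w hw), hr, ?_⟩
    intro w hw
    rw [List.getLast_cons (by simp)]
    rcases List.mem_cons.1 hw with rfl | hw
    · refine ReflTransGen.tail (hl (G.source t) (by simp)) ?_
      rw [hf' (Or.inl rfl)]
      simpa using hat
    · exact hl w hw

/-- A path closed up to a cycle by the star `t` of its end vertex extends to a rooted choice. -/
lemma exists_rooted_of_cycle [Finite W] (hG : G.Connected univ) {s z : W} {l : List W} {t : ι}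
    (hl : G.IsRevPath (s :: l)) (hz : (s :: l).getLast (by simp) = z) (ht : G.source t = s)
    (hzt : z ∈ G.sinks t) :
    ∃ f, G.IsRooted f s ∧ (∀ w ∈ s :: l, w ∈ G.reachSet f s) ∧ G.sinks t ⊆ G.reachSet f s := by
  have hnd := List.nodup_cons.1 hl.nodup
  obtain ⟨f, hf, hr, h⟩ := exists_rooted_of_chain hG l s {s} (fun _ => t) rfl rfl
    (by simpa using ht) (by rintro w rfl; exact ReflTransGen.refl) hnd.2
    (by rintro w hw rfl; exact hnd.1 hw) hl.chain
  have hfs : f s = t := hf rfl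
  have hsub : G.sinks t ⊆ G.reachSet f s := fun w hw =>
    ReflTransGen.single (by rw [hfs]; exact hw)
  refine ⟨f, hr, fun w hw => ?_, hsub⟩
  have h1 := h w hw
  rw [hz] at h1
  exact ReflTransGen.trans (hsub hzt) h1

lemma exists_revPath {Y : W → Prop} {c d : W}
    (h : ReflTransGen (fun a b => G.Arc a b ∧ Y b) c d) :
    ∃ l : List W, G.IsRevPath (d :: l) ∧ (d :: l).getLast (by simp) = c ∧
      ∀ w ∈ d :: l, w = c ∨ Y w := by
  induction h with
  | refl => exact ⟨[], ⟨by simp, by simp⟩, rfl, by simp⟩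
  | @tail b e _ hbe ih =>
    obtain ⟨l, hl, hlast, hY⟩ := ih
    by_cases he : e ∈ b :: l
    · obtain ⟨l₁, l₂, hsplit⟩ := List.append_of_mem he
      refine ⟨l₂, ⟨?_, ?_⟩, ?_, ?_⟩
      · have := hl.nodup
        rw [hsplit] at this
        exact (List.nodup_append.1 this).2.1
      · have := hl.chain
        rw [hsplit] at this
        exact this.right_of_append
      · rw [← hlast]
        simp [hsplit]
      · intro w hw
        exact hY w (by rw [hsplit]; exact List.mem_append_right _ hw)
    · refine ⟨b :: l, ⟨List.nodup_cons.2 ⟨he, hl.nodup⟩, ?_⟩, ?_, ?_⟩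
      · exact List.isChain_cons_cons.2 ⟨hbe.1, hl.chain⟩
      · simpa using hlast
      · intro w hw
        rcases List.mem_cons.1 hw with rfl | hw
        · exact Or.inr hbe.2
        · exact hY w hw

variable (G) in
/-- The path `l`, listed from its end back to its start, is closed up by a star `t` of its end. -/
structure IsClosedBy (l : List W) (t : ι) : Prop where
  path : G.IsRevPath l
  head : l.head? = some (G.source t)
  last : ∃ z, l.getLast? = some z ∧ z ∈ G.sinks t

variable (G) in
def span (l : List W) (t : ι) : Set W :=
  {w | w ∈ l ∨ w ∈ G.sinks t}

lemma IsClosedBy.exists_rooted [Finite W] (hG : G.Connected univ) {l : List W} {t : ι}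
    (h : G.IsClosedBy l t) :
    ∃ f, G.IsRooted f (G.source t) ∧ G.span l t ⊆ G.reachSet f (G.source t) := by
  obtain ⟨z, hz, hzt⟩ := h.last
  cases l with
  | nil => simp at hz
  | cons s l =>
    obtain rfl : s = G.source t := by simpa using h.head
    rw [List.getLast?_eq_some_getLast (by simp)] at hz
    obtain ⟨f, hr, h1, h2⟩ := exists_rooted_of_cycle hG h.path (Option.some.inj hz) rfl hzt
    exact ⟨f, hr, fun w hw => hw.elim (h1 w) (fun hw => h2 hw)⟩

variable (G) in
/-- No closed-up path allows a contraction that pays for itself. -/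
structure IsStuck : Prop where
  connected : G.Connected univ
  small : ∀ {l t A b c d}, G.IsClosedBy l t → (∀ v, G.Arc A v → v ∈ G.span l t) →
    (∀ w ∈ [A, b, c, d], w ∈ G.span l t) → [A, b, c, d].Nodup → False
  cut : ∀ {l t A S}, G.IsClosedBy l t → A ∈ G.span l t → (∀ v, G.Arc A v → v ∈ G.span l t) →
    S.Nonempty → S ≠ univ →
    (∀ t', G.Crosses S t' → G.source t' ≠ A ∧ G.Inside (G.span l t) t') → False

lemma IsRevPath.cons {a : W} {l : List W} (hl : G.IsRevPath l) (ha : a ∉ l)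
    (h : ∀ b ∈ l.head?, G.Arc b a) : G.IsRevPath (a :: l) :=
  ⟨List.nodup_cons.2 ⟨ha, hl.nodup⟩, List.isChain_cons.2 ⟨h, hl.chain⟩⟩

lemma IsRevPath.concat {a : W} {l : List W} (hl : G.IsRevPath l) (ha : a ∉ l)
    (h : ∀ b ∈ l.getLast?, G.Arc a b) : G.IsRevPath (l ++ [a]) := by
  refine ⟨?_, List.isChain_append.2 ⟨hl.chain, by simp, ?_⟩⟩
  · rw [List.nodup_append]
    refine ⟨hl.nodup, by simp, ?_⟩
    rintro b hb c hc rfl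
    exact ha (by simpa [List.mem_singleton.1 hc] using hb)
  · intro b hb c hc
    obtain rfl : a = c := by simpa using hc
    exact h b hb

lemma IsRevPath.left {l m : List W} (h : G.IsRevPath (l ++ m)) : G.IsRevPath l :=
  ⟨(List.nodup_append.1 h.nodup).1, h.chain.left_of_append⟩

lemma IsRevPath.tail {a : W} {l : List W} (h : G.IsRevPath (a :: l)) : G.IsRevPath l :=
  ⟨(List.nodup_cons.1 h.nodup).2, h.chain.tail⟩

lemma IsRevPath.arc {a b : W} {l : List W} (h : G.IsRevPath (a :: b :: l)) : G.Arc b a :=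
  (List.isChain_cons_cons.1 h.chain).1

lemma isRevPath_singleton (a : W) : G.IsRevPath [a] := ⟨by simp, by simp⟩

lemma isRevPath_pair {a b : W} (h : G.Arc b a) : G.IsRevPath [a, b] :=
  (isRevPath_singleton b).cons (by simpa using h.1.symm) (by simpa using h)

lemma isRevPath_triple {a b c : W} (hba : G.Arc b a) (hcb : G.Arc c b) (hac : a ≠ c) :
    G.IsRevPath [a, b, c] :=
  (isRevPath_pair hcb).cons (by simp [hba.1.symm, hac]) (by simpa using hba)

lemma Inside.of_arc {Q : Set W} {t : ι} (hs : G.source t ∈ Q)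
    (h : ∀ v, G.Arc (G.source t) v → v ∈ Q) : G.Inside Q t := by
  refine ⟨hs, fun v hv => ?_⟩
  by_cases hvs : G.source t = v
  · exact hvs ▸ hs
  · exact h v ⟨hvs, t, rfl, hv⟩

lemma Crosses.source_of_compl_singleton {A : W} {t : ι} (h : G.Crosses {A}ᶜ t) :
    G.Arc (G.source t) A ∧ A ∈ G.sinks t := by
  obtain ⟨hs, v, hv, hvA⟩ := h
  obtain rfl : v = A := by simpa using hvA
  exact ⟨⟨hs, t, rfl, hv⟩, hv⟩

/-- In a stuck system, a vertex with a single out-neighbour `q` has `q` as its only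
in-neighbour. -/
lemma IsStuck.eq_of_arc_of_unique_out (h : G.IsStuck) {A q p : W} (hAq : G.Arc A q)
    (hA : ∀ v, G.Arc A v → v = q) (hp : G.Arc p A) : p = q := by
  by_contra hpq
  obtain ⟨hne, t₀, ht₀, hqt₀⟩ := id hAq
  let r : W → W → Prop := fun a b => G.Arc a b ∧ (b ≠ p ∧ b ≠ A)
  let S : Set W := insert A {w | ReflTransGen r q w}
  have hY : ∀ w, ReflTransGen r q w → w ≠ p ∧ w ≠ A := by
    intro w hw
    rcases ReflTransGen.cases_tail hw with rfl | ⟨_, _, h2⟩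
    · exact ⟨Ne.symm hpq, hne.symm⟩
    · exact h2.2
  have hpS : p ∉ S := by
    rintro (h1 | h1)
    · exact hp.1 h1
    · exact (hY p h1).1 rfl
  have hcross : ∀ t, G.Crosses S t → G.source t = q ∧ p ∈ G.sinks t := by
    rintro t ⟨hs, v, hv, hvS⟩
    have hvA : v ≠ A := fun h1 => hvS (Or.inl h1)
    have harc : G.Arc (G.source t) v := ⟨by rintro h1; exact hvS (h1 ▸ hs), t, rfl, hv⟩
    rcases hs with hs | hs
    · rw [hs] at harc
      exact absurd (Or.inr (by rw [hA v harc]; exact ReflTransGen.refl)) hvS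
    · have hvp : v = p := by
        by_contra hvp
        exact hvS (Or.inr (ReflTransGen.tail hs ⟨harc, hvp, hvA⟩))
      subst hvp
      refine ⟨?_, hv⟩
      by_contra hyq
      obtain ⟨l, hl, hlast, hlY⟩ := exists_revPath (G := G) (Y := fun b => b ≠ v ∧ b ≠ A) hs
      have hlY' : ∀ w ∈ G.source t :: l, w ≠ v ∧ w ≠ A := by
        intro w hw
        rcases hlY w hw with rfl | h1
        · exact ⟨Ne.symm hpq, hne.symm⟩
        · exact h1
      have hpath : G.IsRevPath (A :: v :: G.source t :: l) := by
        refine (hl.cons (fun h1 => (hlY' _ h1).1 rfl) (by simpa using harc)).cons ?_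
          (by simpa using hp)
        intro h1
        rcases List.mem_cons.1 h1 with h1 | h1
        · exact hvA h1.symm
        · exact (hlY' _ h1).2 rfl
      have hql : q ∈ G.source t :: l := hlast ▸ List.getLast_mem _
      have hclosed : G.IsClosedBy (A :: v :: G.source t :: l) t₀ := by
        refine ⟨hpath, by simp [ht₀], q, ?_, hqt₀⟩
        rw [List.getLast?_cons_cons, List.getLast?_cons_cons,
          List.getLast?_eq_some_getLast (by simp), hlast]
      refine h.small (A := A) (b := v) (c := G.source t) (d := q) hclosed ?_ ?_ ?_
      · intro w hw
        rw [hA w hw]; exact Or.inr hqt₀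
      · intro w hw
        simp only [List.mem_cons, List.not_mem_nil, or_false] at hw
        rcases hw with rfl | rfl | rfl | rfl
        · exact Or.inl (by simp)
        · exact Or.inl (by simp)
        · exact Or.inl (by simp)
        · exact Or.inr hqt₀
      · have h1 := hlY' (G.source t) (by simp)
        simp [hvA.symm, h1.1.symm, h1.2.symm, hne, hpq, hyq]
  have hSne : S.Nonempty := ⟨A, Or.inl rfl⟩
  have hSu : S ≠ univ := fun h1 => hpS (h1 ▸ trivial)
  have hclosed : ∀ t, G.Crosses S t → G.IsClosedBy [q, A, p] t := fun t ht =>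
    ⟨isRevPath_triple hAq hp (Ne.symm hpq), by simp [(hcross t ht).1], p, by simp,
      (hcross t ht).2⟩
  have hsub : ∀ t, G.Crosses S t → ∀ c ∈ G.sinks t, c ∈ [q, A, p] := by
    intro t ht c hc
    by_contra hcn
    simp only [List.mem_cons, List.not_mem_nil, or_false, not_or] at hcn
    refine h.small (A := A) (b := p) (c := q) (d := c) (hclosed t ht) ?_ ?_ ?_
    · intro w hw
      rw [hA w hw]; exact Or.inl (by simp)
    · intro w hw
      simp only [List.mem_cons, List.not_mem_nil, or_false] at hw
      rcases hw with rfl | rfl | rfl | rfl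
      · exact Or.inl (by simp)
      · exact Or.inl (by simp)
      · exact Or.inl (by simp)
      · exact Or.inr hc
    · simp [hp.1.symm, hne, hpq, Ne.symm hcn.1, Ne.symm hcn.2.1, Ne.symm hcn.2.2]
  obtain ⟨t, -, ht⟩ := h.connected S hSne hSu
  refine h.cut (A := A) (hclosed t ht) (Or.inl (by simp)) ?_ hSne hSu ?_
  · intro w hw
    rw [hA w hw]; exact Or.inl (by simp)
  · intro t' ht'
    have h1 := (hcross t' ht').1
    refine ⟨by rw [h1]; exact hne.symm, ?_, fun w hw => Or.inl (hsub t' ht' w hw)⟩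
    rw [h1]; exact Or.inl (by simp)

variable (G) in
structure IsLongest (l : List W) : Prop where
  path : G.IsRevPath l
  length_le : ∀ l', G.IsRevPath l' → l'.length ≤ l.length

lemma exists_isLongest [Finite W] : ∃ l, G.IsLongest l := by
  classical
  have := Fintype.ofFinite W
  obtain ⟨l, hl, hmax⟩ := Set.exists_max_image
    {l : List W | G.IsRevPath l} List.length
    ((List.finite_length_le W (Fintype.card W)).subset fun l hl => hl.nodup.length_le_card)
    ⟨[], ⟨by simp, by simp⟩⟩
  exact ⟨l, hl, hmax⟩

lemma IsLongest.mem_of_arc {A v : W} {l : List W} (h : G.IsLongest (A :: l)) (hv : G.Arc A v) :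
    v ∈ l := by
  by_contra hvl
  have := h.length_le (v :: A :: l) (h.path.cons
    (by simpa [hv.1.symm] using hvl) (by simpa using hv))
  simp at this

lemma IsLongest.swap {A p c : W} {l : List W} (h : G.IsLongest (A :: p :: l)) (hpc : G.Arc p c)
    (hc : c ∉ p :: l) : G.IsLongest (c :: p :: l) :=
  ⟨h.path.tail.cons hc (by simpa using hpc), fun l' hl' => by simpa using h.length_le l' hl'⟩

lemma exists_last_append_of_mem {α : Type*} (P : α → Prop) :
    ∀ {l : List α}, (∃ z ∈ l, P z) → ∃ l₁ z l₂, l = l₁ ++ z :: l₂ ∧ P z ∧ ∀ w ∈ l₂, ¬ P w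
  | [], h => by simp at h
  | a :: l, h => by
    by_cases hl : ∃ z ∈ l, P z
    · obtain ⟨l₁, z, l₂, rfl, hz⟩ := exists_last_append_of_mem P hl
      exact ⟨a :: l₁, z, l₂, rfl, hz⟩
    · refine ⟨[], a, l, rfl, ?_, fun w hw hPw => hl ⟨w, hw, hPw⟩⟩
      obtain ⟨z, hz, hPz⟩ := h
      rcases List.mem_cons.1 hz with rfl | hz
      · exact hPz
      · exact absurd ⟨z, hz, hPz⟩ hl

lemma IsStuck.longest_cases [Nontrivial W] (h : G.IsStuck) {A : W} {l : List W}
    (hl : G.IsLongest (A :: l)) :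
    (∃ q l', l = q :: l' ∧ G.Arc A q ∧ ∀ v, G.Arc A v → v = q) ∨
      ∃ p g l', l = p :: g :: l' ∧ G.Arc A g ∧ ∀ v, G.Arc A v → v = p ∨ v = g := by
  obtain ⟨b, hb⟩ := exists_ne A
  obtain ⟨t, -, ht, v, hv, hvA⟩ := h.connected {A} ⟨A, rfl⟩
    (fun h1 => hb (by have h2 := Set.mem_univ b; rwa [← h1] at h2))
  have hAv : G.Arc A v := ⟨fun h1 => hvA h1.symm, t, ht, hv⟩
  obtain ⟨l₁, z, l₂, rfl, hAz, hl₂⟩ :=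
    exists_last_append_of_mem (G.Arc A) ⟨v, hl.mem_of_arc hAv, hAv⟩
  obtain ⟨-, t₀, ht₀, hzt₀⟩ := id hAz
  have hout : ∀ v, G.Arc A v → v ∈ l₁ ++ [z] := by
    intro v hv
    have := hl.mem_of_arc hv
    rw [List.mem_append, List.mem_cons] at this
    rcases this with h1 | h1 | h1
    · simp [h1]
    · simp [h1]
    · exact absurd hv (hl₂ v h1)
  match l₁, hl, hout with
  | [], _, hout => exact Or.inl ⟨z, l₂, rfl, hAz, by simpa using hout⟩
  | [p], _, hout => exact Or.inr ⟨p, z, l₂, rfl, hAz, by simpa using hout⟩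
  | p :: g :: l₁, hl, hout =>
    exfalso
    have hpath : G.IsRevPath (A :: p :: g :: (l₁ ++ [z])) := by
      have h1 : A :: (p :: g :: l₁ ++ z :: l₂) = (A :: p :: g :: (l₁ ++ [z])) ++ l₂ := by simp
      exact (h1 ▸ hl.path).left
    have hmem : ∀ w, w ∈ A :: p :: g :: (l₁ ++ [z]) →
        w ∈ G.span (A :: p :: g :: (l₁ ++ [z])) t₀ := fun w hw => Or.inl hw
    refine h.small (A := A) (b := p) (c := g) (d := z)
      ⟨hpath, by simp [ht₀], z, List.getLast?_concat (l := A :: p :: g :: l₁), hzt₀⟩ ?_ ?_ ?_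
    · intro v hv
      exact hmem v (List.mem_cons_of_mem _ (by simpa using hout v hv))
    · intro w hw
      apply hmem
      simp only [List.mem_cons, List.not_mem_nil, or_false] at hw
      rcases hw with rfl | rfl | rfl | rfl <;> simp
    · refine hpath.nodup.sublist ?_
      simp

/-- In a stuck system, the end of a longest path has at least two out-neighbours. -/
lemma IsStuck.false_of_unique_out [Nontrivial W] (h : G.IsStuck) {A q r : W} {l : List W}
    (hl : G.IsLongest (A :: r :: l)) (hAq : G.Arc A q) (hA : ∀ v, G.Arc A v → v = q) : False := by
  obtain rfl : r = q := h.eq_of_arc_of_unique_out hAq hA hl.path.arc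
  obtain ⟨hne, -⟩ := id hAq
  have hrl : r ∉ l := (List.nodup_cons.1 hl.path.tail.nodup).1
  have hAl : A ∉ l := fun h1 => (List.nodup_cons.1 hl.path.nodup).1 (by simp [h1])
  have hclosed : ∀ t, G.source t = r → A ∈ G.sinks t → G.IsClosedBy [r, A] t := fun t ht hAt =>
    ⟨isRevPath_pair hAq, by simp [ht], A, by simp, hAt⟩
  have hr : ∀ t, G.Crosses {A}ᶜ t → G.source t = r ∧ A ∈ G.sinks t := fun t ht =>
    ⟨h.eq_of_arc_of_unique_out hAq hA ht.source_of_compl_singleton.1,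
      ht.source_of_compl_singleton.2⟩
  have hSne : ({A}ᶜ : Set W).Nonempty := ⟨r, hne.symm⟩
  have hSu : ({A}ᶜ : Set W) ≠ univ := fun h1 => absurd (Set.mem_univ A) (by rw [← h1]; simp)
  have houtA : ∀ l' t, r ∈ l' → ∀ v, G.Arc A v → v ∈ G.span l' t := fun l' t hr' v hv => by
    rw [hA v hv]; exact Or.inl hr'
  by_cases hoff : ∃ t b, G.source t = r ∧ A ∈ G.sinks t ∧ b ∈ G.sinks t ∧ b ∉ A :: r :: l
  · obtain ⟨t, b, ht, hAt, hbt, hbl⟩ := hoff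
    simp only [List.mem_cons, not_or] at hbl
    have hrb : G.Arc r b := ⟨fun h1 => hbl.2.1 h1.symm, t, ht, hbt⟩
    have hlb : G.IsLongest (b :: r :: l) := hl.swap hrb (by simp [hbl])
    have hb : ∀ v, G.Arc b v → v = r := by
      intro v hv
      rcases List.mem_cons.1 (hlb.mem_of_arc hv) with h1 | hvl
      · exact h1
      exfalso
      obtain ⟨l₁, l₂, rfl⟩ := List.append_of_mem hvl
      have hpath : G.IsRevPath (r :: (l₁ ++ [v]) ++ [b]) := by
        have h1 : G.IsRevPath ((r :: (l₁ ++ [v])) ++ l₂) := by simpa using hl.path.tail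
        refine h1.left.concat ?_ (fun w hw => ?_)
        · have h2 := hbl.2.2
          simp only [List.mem_append, List.mem_cons, not_or] at h2
          simp [hbl.2.1, h2.1, h2.2.1]
        · have hw' : (r :: (l₁ ++ [v])).getLast? = some v := by
            rw [← List.cons_append, List.getLast?_concat]
          rw [hw'] at hw
          obtain rfl : v = w := by simpa using hw
          exact hv
      refine h.small (A := A) (b := r) (c := b) (d := v)
        ⟨hpath, by simp [ht], b, List.getLast?_concat, hbt⟩ (houtA _ _ (by simp)) ?_ ?_
      · intro w hw
        simp only [List.mem_cons, List.not_mem_nil, or_false] at hw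
        rcases hw with rfl | rfl | rfl | rfl
        · exact Or.inr hAt
        · exact Or.inl (by simp)
        · exact Or.inl (by simp)
        · exact Or.inl (by simp)
      · have h1 : A ≠ v := fun h1 => hAl (h1 ▸ hvl)
        have h2 : r ≠ v := fun h1 => hrl (h1 ▸ hvl)
        simp [hne, h1, h2, Ne.symm hbl.1, Ne.symm hbl.2.1, hv.1]
    refine h.cut (A := A) (S := {b}) (hclosed t ht hAt) (Or.inl (by simp)) (houtA _ _ (by simp))
      ⟨b, rfl⟩ (fun h1 => hbl.1 (by simpa using (h1 ▸ Set.mem_univ A : A ∈ ({b} : Set W)).symm)) ?_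
    rintro t' ⟨hs, -⟩
    obtain rfl : G.source t' = b := hs
    exact ⟨hbl.1, Inside.of_arc (Or.inr hbt) fun v hv => Or.inl (by simp [hb v hv])⟩
  · push Not at hoff
    by_cases hon : ∃ t b, G.source t = r ∧ A ∈ G.sinks t ∧ b ∈ G.sinks t ∧ b ≠ A ∧ b ≠ r
    · have hhead : ∀ t b, G.source t = r → A ∈ G.sinks t → b ∈ G.sinks t → b ≠ A → b ≠ r →
          l.head? = some b := by
        intro t b ht hAt hbt hbA hbr
        have hbl : b ∈ l := by
          simpa [hbA, hbr] using hoff t b ht hAt hbt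
        obtain ⟨l₁, l₂, rfl⟩ := List.append_of_mem hbl
        cases l₁ with
        | nil => rfl
        | cons k l₁ =>
          exfalso
          have hpath : G.IsRevPath (r :: k :: (l₁ ++ [b])) := by
            have h1 : G.IsRevPath ((r :: k :: (l₁ ++ [b])) ++ l₂) := by
              simpa using hl.path.tail
            exact h1.left
          refine h.small (A := A) (b := r) (c := k) (d := b)
            ⟨hpath, by simp [ht], b, List.getLast?_concat (l := r :: k :: l₁), hbt⟩
            (houtA _ _ (by simp)) ?_ ?_
          · intro w hw
            simp only [List.mem_cons, List.not_mem_nil, or_false] at hw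
            rcases hw with rfl | rfl | rfl | rfl
            · exact Or.inr hAt
            · exact Or.inl (by simp)
            · exact Or.inl (by simp)
            · exact Or.inl (by simp)
          · refine hl.path.nodup.sublist ?_
            simp
      obtain ⟨t, b, ht, hAt, hbt, hbA, hbr⟩ := hon
      refine h.cut (A := A) (hclosed t ht hAt) (Or.inl (by simp)) (houtA _ _ (by simp)) hSne hSu ?_
      intro t' ht'
      obtain ⟨hs', hAt'⟩ := hr t' ht'
      refine ⟨by rw [hs']; exact hne.symm, by rw [hs']; exact Or.inl (by simp), fun c hc => ?_⟩
      by_cases hcA : c = A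
      · exact Or.inl (by simp [hcA])
      by_cases hcr : c = r
      · exact Or.inl (by simp [hcr])
      have h1 := hhead t b ht hAt hbt hbA hbr
      rw [hhead t' c hs' hAt' hc hcA hcr] at h1
      obtain rfl : c = b := by simpa using h1
      exact Or.inr hbt
    · push Not at hon
      obtain ⟨t, -, ht⟩ := h.connected _ hSne hSu
      refine h.cut (A := A) (hclosed t (hr t ht).1 (hr t ht).2) (Or.inl (by simp))
        (houtA _ _ (by simp)) hSne hSu ?_
      intro t' ht'
      obtain ⟨hs', hAt'⟩ := hr t' ht'
      refine ⟨by rw [hs']; exact hne.symm, by rw [hs']; exact Or.inl (by simp), fun c hc => ?_⟩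
      by_cases hcA : c = A
      · exact Or.inl (by simp [hcA])
      · exact Or.inl (by simp [hon t' c hs' hAt' hc hcA])

lemma IsStuck.exists_detour [Nontrivial W] (h : G.IsStuck) {A p g c : W} {l : List W}
    (hl : G.IsLongest (A :: p :: g :: l)) (hpc : G.Arc p c) (hcA : c ≠ A) (hcg : c ≠ g) :
    ∃ m, G.IsRevPath (g :: m) ∧ (g :: m).getLast? = some c ∧ c ∈ m ∧ p ∉ m ∧ A ∉ m := by
  by_cases hc : c ∈ l
  · obtain ⟨l₁, l₂, rfl⟩ := List.append_of_mem hc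
    have h1 : A :: p :: g :: (l₁ ++ c :: l₂) = A :: p :: ((g :: (l₁ ++ [c])) ++ l₂) := by simp
    have hpath := h1 ▸ hl.path
    have hA := (List.nodup_cons.1 hpath.nodup).1
    have hp := (List.nodup_cons.1 hpath.tail.nodup).1
    refine ⟨l₁ ++ [c], hpath.tail.tail.left, List.getLast?_concat (l := g :: l₁), by simp, ?_, ?_⟩
    · intro h2
      exact hp (List.mem_append_left _ (List.mem_cons_of_mem _ h2))
    · intro h2
      exact hA (List.mem_cons_of_mem _ (List.mem_append_left _ (List.mem_cons_of_mem _ h2)))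
  · have hlc := hl.swap hpc (by simp [hpc.1.symm, hcg, hc])
    rcases h.longest_cases hlc with ⟨q, l', -, hq, hq'⟩ | ⟨p', g', l', heq, hg, -⟩
    · exact (h.false_of_unique_out hlc hq hq').elim
    · obtain ⟨rfl, rfl, rfl⟩ : p = p' ∧ g = g' ∧ l = l' := by simpa using heq
      exact ⟨[c], isRevPath_pair hg, by simp, by simp, by simpa using hpc.1,
        by simpa using hcA.symm⟩

lemma IsStuck.false_of_two_out [Nontrivial W] (h : G.IsStuck) {A p g : W} {l : List W}
    (hl : G.IsLongest (A :: p :: g :: l)) (hAp : G.Arc A p) (hAg : G.Arc A g)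
    (hA : ∀ v, G.Arc A v → v = p ∨ v = g) : False := by
  have hpA := hl.path.arc
  have hgp := hl.path.tail.arc
  obtain ⟨-, tp, htp, hptp⟩ := id hAp
  obtain ⟨-, tg, htg, hgtg⟩ := id hAg
  have hout : ∀ l' t, p ∈ G.span l' t → g ∈ G.span l' t → ∀ v, G.Arc A v → v ∈ G.span l' t :=
    fun l' t h1 h2 v hv => (hA v hv).elim (fun h3 => h3 ▸ h1) (fun h3 => h3 ▸ h2)
  have hsub : ∀ t, G.source t = p → A ∈ G.sinks t → ∀ c ∈ G.sinks t, c ∈ [A, p, g] := by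
    intro t ht hAt c hc
    by_contra hcn
    simp only [List.mem_cons, List.not_mem_nil, or_false, not_or] at hcn
    refine h.small (l := [p, g, A]) (t := t) (A := A) (b := p) (c := g) (d := c)
      ⟨isRevPath_triple hgp hAg hpA.1, by simp [ht], A, by simp, hAt⟩
      (hout _ _ (Or.inl (by simp)) (Or.inl (by simp))) ?_ ?_
    · intro w hw
      simp only [List.mem_cons, List.not_mem_nil, or_false] at hw
      rcases hw with rfl | rfl | rfl | rfl
      · exact Or.inl (by simp)
      · exact Or.inl (by simp)
      · exact Or.inl (by simp)
      · exact Or.inr hc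
    · simp [hAp.1, hAg.1, hgp.1.symm, Ne.symm hcn.1, Ne.symm hcn.2.1, Ne.symm hcn.2.2]
  have hclosed : G.IsClosedBy [A, p, g] tg :=
    ⟨isRevPath_triple hpA hgp hAg.1, by simp [htg], g, by simp, hgtg⟩
  have hout' := hout [A, p, g] tg (Or.inl (by simp)) (Or.inl (by simp))
  have hne_univ : ∀ {S : Set W} {w : W}, w ∉ S → S ≠ univ := fun hw h1 => hw (h1 ▸ trivial)
  by_cases hpc : ∃ c, G.Arc p c ∧ c ≠ A ∧ c ≠ g
  · obtain ⟨c, hpc, hcA, hcg⟩ := hpc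
    obtain ⟨m, hm, hmlast, hcm, hpm, hAm⟩ := h.exists_detour hl hpc hcA hcg
    have hin : ∀ a, G.Arc a A → a = p := by
      intro a ha
      by_contra hap
      by_cases hag : a = g
      · subst hag
        have hpath : G.IsRevPath (A :: a :: m ++ [p]) := by
          refine (hm.cons (by simp [hAg.1, hAm]) (by simpa using ha)).concat
            (by simp [hAp.1.symm, hgp.1.symm, hpm]) ?_
          intro w hw
          rw [List.getLast?_cons_cons, hmlast] at hw
          obtain rfl : c = w := by simpa using hw
          exact hpc
        refine h.small (A := A) (b := a) (c := c) (d := p)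
          ⟨hpath, by simp [htp], p, List.getLast?_concat (l := A :: a :: m), hptp⟩
          (hout _ _ (Or.inl (by simp)) (Or.inl (by simp))) ?_ ?_
        · intro w hw
          refine Or.inl ?_
          simp only [List.mem_cons, List.not_mem_nil, or_false] at hw
          rcases hw with rfl | rfl | rfl | rfl <;> simp [hcm]
        · simp [hAp.1, hAg.1, hgp.1, hcA.symm, Ne.symm hcg, hpc.1.symm]
      · let r : W → W → Prop := fun u v => G.Arc u v ∧ v ≠ A
        have hreach : ∀ {l' : List W} {d : W}, G.IsRevPath (d :: l') → A ∉ d :: l' →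
            ∀ z ∈ (d :: l').getLast?, ReflTransGen r z d := by
          intro l'
          induction l' with
          | nil => intro d _ _ z hz; obtain rfl : d = z := by simpa using hz
                   exact ReflTransGen.refl
          | cons e l' ih =>
            intro d hd hAd z hz
            simp only [List.mem_cons, not_or] at hAd
            exact ReflTransGen.tail (ih hd.tail (by simpa using hAd.2) z
              (by rwa [List.getLast?_cons_cons] at hz)) ⟨hd.arc, Ne.symm hAd.1⟩
        have hpg : ReflTransGen r p g :=
          ReflTransGen.head ⟨hpc, hcA⟩ (hreach hm (by simp [hAg.1, hAm]) c (by simp [hmlast]))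
        have hpa : ReflTransGen r p a := by
          by_contra hpa
          have haS : a ∉ insert A {w | ReflTransGen r p w} := by
            rintro (h1 | h1)
            · exact ha.1 h1
            · exact hpa h1
          obtain ⟨t, -, hs, v, hv, hvS⟩ := h.connected (insert A {w | ReflTransGen r p w})
            ⟨A, Or.inl rfl⟩ (hne_univ haS)
          have hvA : v ≠ A := fun h1 => hvS (Or.inl h1)
          have harc : G.Arc (G.source t) v := ⟨fun h1 => hvS (h1 ▸ hs), t, rfl, hv⟩
          rcases hs with hs | hs
          · rw [hs] at harc
            rcases hA v harc with rfl | rfl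
            · exact hvS (Or.inr ReflTransGen.refl)
            · exact hvS (Or.inr hpg)
          · exact hvS (Or.inr (ReflTransGen.tail hs ⟨harc, hvA⟩))
        obtain ⟨L, hL, hLlast, hLY⟩ := exists_revPath (G := G) (Y := fun v => v ≠ A) hpa
        have hAL : A ∉ a :: L := fun h1 => (hLY A h1).elim hAp.1 (fun h2 => h2 rfl)
        have hpL : p ∈ a :: L := hLlast ▸ List.getLast_mem _
        have hLlast' : (a :: L).getLast? = some p := by
          rw [List.getLast?_eq_some_getLast (by simp), hLlast]
        have hAL' : G.IsRevPath (A :: a :: L) := hL.cons hAL (by simpa using ha)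
        have hnd : [A, p, a, g].Nodup := by
          simp [hAp.1, hAg.1, hgp.1.symm, ha.1.symm, hag, Ne.symm hap]
        by_cases hgL : g ∈ a :: L
        · refine h.small (A := A) (b := p) (c := a) (d := g)
            ⟨hAL', by simp [htp], p, by rw [List.getLast?_cons_cons, hLlast'], hptp⟩
            (hout _ _ (Or.inr hptp) (Or.inl (List.mem_cons_of_mem _ hgL))) ?_ hnd
          intro w hw
          refine Or.inl ?_
          simp only [List.mem_cons, List.not_mem_nil, or_false] at hw
          rcases hw with rfl | rfl | rfl | rfl
          · simp
          · exact List.mem_cons_of_mem _ hpL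
          · simp
          · exact List.mem_cons_of_mem _ hgL
        · have hpath : G.IsRevPath (A :: a :: L ++ [g]) := by
            refine hAL'.concat ?_ ?_
            · rw [List.mem_cons, not_or]
              exact ⟨hAg.1.symm, hgL⟩
            · intro w hw
              rw [List.getLast?_cons_cons, hLlast'] at hw
              obtain rfl : p = w := by simpa using hw
              exact hgp
          have hpS : p ∈ A :: a :: L ++ [g] :=
            List.mem_append_left _ (List.mem_cons_of_mem _ hpL)
          refine h.small (A := A) (b := p) (c := a) (d := g)
            ⟨hpath, by simp [htg], g, List.getLast?_concat (l := A :: a :: L), hgtg⟩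
            (hout _ _ (Or.inl hpS) (Or.inr hgtg)) ?_ hnd
          intro w hw
          refine Or.inl ?_
          simp only [List.mem_cons, List.not_mem_nil, or_false] at hw
          rcases hw with rfl | rfl | rfl | rfl
          · simp
          · exact hpS
          · simp
          · simp
    refine h.cut (A := A) (S := {A}ᶜ) hclosed (Or.inl (by simp)) hout' ⟨p, hAp.1.symm⟩
      (hne_univ (w := A) (by simp)) ?_
    intro t' ht'
    obtain ⟨harc, hAt'⟩ := ht'.source_of_compl_singleton
    have hs := hin _ harc
    exact ⟨by rw [hs]; exact hpA.1, by rw [hs]; exact Or.inl (by simp),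
      fun v hv => Or.inl (hsub t' hs hAt' v hv)⟩
  · push Not at hpc
    refine h.cut (A := A) (S := {p}) hclosed (Or.inl (by simp)) hout' ⟨p, rfl⟩
      (hne_univ (w := A) (by simpa using hAp.1)) ?_
    rintro t' ⟨hs, -⟩
    obtain rfl : G.source t' = p := hs
    refine ⟨hpA.1, Inside.of_arc (Or.inl (by simp)) fun v hv => Or.inl ?_⟩
    by_cases hvA : v = A
    · simp [hvA]
    · simp [hpc v hv hvA]

lemma IsStuck.false [Finite W] [Nontrivial W] (h : G.IsStuck) : False := by
  obtain ⟨l, hl⟩ := G.exists_isLongest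
  cases l with
  | nil =>
    obtain ⟨a⟩ := (inferInstance : Nonempty W)
    simpa using hl.length_le [a] (isRevPath_singleton a)
  | cons A l =>
    rcases h.longest_cases hl with ⟨q, l', rfl, hq, hq'⟩ | ⟨p, g, l', rfl, hg, hpg⟩
    · exact h.false_of_unique_out hl hq hq'
    · by_cases hp : G.Arc A p
      · exact h.false_of_two_out hl hp hg hpg
      · refine h.false_of_unique_out hl hg fun v hv => (hpg v hv).resolve_left ?_
        rintro rfl
        exact hp hv

/-- The total weight of the stars inside `Q`. -/
noncomputable def weightInside [Fintype ι] (G : StarSystem W ι) (x : ι → ℝ) (Q : Set W) : ℝ :=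
  ∑ t, {t | G.Inside Q t}.indicator x t

/-- A vertex set `Q` pays for the contraction of `Q` by one star per vertex of `Q`. -/
def PaysFor [Fintype ι] (G : StarSystem W ι) (x : ι → ℝ) (Q : Set W) : Prop :=
  (4 ≤ Q.ncard ∧ 1 ≤ G.weightInside x Q) ∨ (2 ≤ Q.ncard ∧ 2 ≤ G.weightInside x Q)

lemma IsFractional.connected [Fintype ι] {x : ι → ℝ} (hx : G.IsFractional x) :
    G.Connected univ := by
  intro S hS hSu
  by_contra hcon
  push Not at hcon
  have h1 := hx.cut S hS hSu
  rw [Finset.sum_eq_zero fun t _ => Set.indicator_of_notMem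
    (s := {t | G.Crosses S t}) (hcon t trivial) x] at h1
  norm_num at h1

lemma IsFractional.exists_paysFor [Finite W] [Nontrivial W] [Fintype ι] {x : ι → ℝ}
    (hx : G.IsFractional x) : ∃ f s, G.IsRooted f s ∧ G.PaysFor x (G.reachSet f s) := by
  by_contra hcon
  have hsingle : ∀ A : W, ({A} : Set W) ≠ univ := by
    intro A h1
    obtain ⟨b, hb⟩ := exists_ne A
    have h2 := Set.mem_univ b
    rw [← h1] at h2
    exact hb h2
  have hA : ∀ {A Q t}, A ∈ Q → (∀ v, G.Arc A v → v ∈ Q) → G.Crosses {A} t → G.Inside Q t := by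
    rintro A Q t hAQ hout ⟨hs, -⟩
    obtain rfl : G.source t = A := hs
    exact Inside.of_arc hAQ hout
  refine IsStuck.false (G := G) ⟨hx.connected, ?_, ?_⟩
  · intro l t A b c d hl hout hmem hnd
    obtain ⟨f, hf, hsub⟩ := hl.exists_rooted hx.connected
    refine hcon ⟨f, _, hf, Or.inl ⟨?_, (hx.cut {A} ⟨A, rfl⟩ (hsingle A)).trans ?_⟩⟩
    · classical
      have h1 := Set.ncard_le_ncard (s := (([A, b, c, d].toFinset : Finset W) : Set W))
        (t := G.reachSet f (G.source t)) (fun w hw => hsub (hmem w (by simpa using hw)))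
        (Set.toFinite _)
      rw [Set.ncard_coe_finset, List.toFinset_card_of_nodup hnd] at h1
      simpa using h1
    · refine Finset.sum_le_sum fun t' _ => ?_
      exact Set.indicator_le_indicator_of_subset
        (fun t' ht' => hA (hsub (hmem A (by simp))) (fun v hv => hsub (hout v hv)) ht')
        hx.nonneg t'
  · intro l t A S hl hAl hout hS hSu hcross
    obtain ⟨f, hf, hsub⟩ := hl.exists_rooted hx.connected
    have hcross' : ∀ t', G.Crosses S t' → G.Inside (G.reachSet f (G.source t)) t' :=
      fun t' ht' => ⟨hsub (hcross t' ht').2.1, (hcross t' ht').2.2.trans hsub⟩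
    refine hcon ⟨f, _, hf, Or.inr ⟨?_, ?_⟩⟩
    · obtain ⟨t', -, ht'⟩ := hx.connected S hS hSu
      obtain ⟨v, hv, hvS⟩ := ht'.2
      refine (Set.one_lt_ncard (Set.toFinite _)).2
        ⟨_, (hcross' t' ht').1, v, (hcross' t' ht').2 hv, fun h1 => hvS (h1 ▸ ht'.1)⟩
    · have h1 := hx.cut {A} ⟨A, rfl⟩ (hsingle A)
      have h2 := hx.cut S hS hSu
      have h3 : ∑ t', ({t' | G.Crosses {A} t'}.indicator x t' +
          {t' | G.Crosses S t'}.indicator x t') ≤ G.weightInside x (G.reachSet f (G.source t)) := by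
        refine Finset.sum_le_sum fun t' _ => ?_
        by_cases h4 : G.Crosses S t'
        · have h5 : ¬ G.Crosses {A} t' := fun h5 => (hcross t' h4).1 h5.1
          simp [h4, h5, hcross' t' h4]
        · simp only [Set.indicator_of_notMem (s := {t' | G.Crosses S t'}) h4, add_zero]
          exact Set.indicator_le_indicator_of_subset
            (fun t' ht' => hA (hsub hAl) (fun v hv => hsub (hout v hv)) ht') hx.nonneg t'
      rw [Finset.sum_add_distrib] at h3
      linarith

open Classical in
/-- The map contracting `Q` to the vertex `r`. -/
noncomputable def proj (Q : Set W) (r w : W) : ↥(insert r Qᶜ) :=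
  if h : w ∈ Q then ⟨r, Or.inl rfl⟩ else ⟨w, Or.inr h⟩

lemma coe_proj_of_mem {Q : Set W} {r w : W} (h : w ∈ Q) : (proj Q r w : W) = r := by
  simp [proj, h]

lemma coe_proj_of_notMem {Q : Set W} {r w : W} (h : w ∉ Q) : (proj Q r w : W) = w := by
  simp [proj, h]

lemma proj_surjective {Q : Set W} {r : W} (hr : r ∈ Q) : Function.Surjective (proj Q r) := by
  rintro ⟨w, rfl | hw⟩
  · exact ⟨w, Subtype.ext (coe_proj_of_mem hr)⟩
  · exact ⟨w, Subtype.ext (coe_proj_of_notMem hw)⟩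

variable (G) in
noncomputable def contract (Q : Set W) (r : W) : StarSystem ↥(insert r Qᶜ) ι where
  source t := proj Q r (G.source t)
  sinks t := proj Q r '' G.sinks t

lemma crosses_contract_iff {Q : Set W} {r : W} {S : Set ↥(insert r Qᶜ)} {t : ι} :
    (G.contract Q r).Crosses S t ↔ G.Crosses (proj Q r ⁻¹' S) t := by
  simp [Crosses, contract]

lemma Crosses.not_inside {Q : Set W} {r : W} {S : Set ↥(insert r Qᶜ)} {t : ι}
    (h : G.Crosses (proj Q r ⁻¹' S) t) : ¬ G.Inside Q t := by
  rintro ⟨hs, hsinks⟩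
  obtain ⟨h1, v, hv, hvS⟩ := h
  refine hvS ?_
  have h2 : proj Q r v = proj Q r (G.source t) :=
    Subtype.ext ((coe_proj_of_mem (hsinks hv)).trans (coe_proj_of_mem hs).symm)
  rw [Set.mem_preimage, h2]
  exact h1

lemma IsFractional.contract [Fintype ι] {x : ι → ℝ} (hx : G.IsFractional x) {Q : Set W} {r : W}
    (hr : r ∈ Q) : (G.contract Q r).IsFractional ({t | G.Inside Q t}ᶜ.indicator x) := by
  refine ⟨fun t => Set.indicator_nonneg (fun t _ => hx.nonneg t) t, fun S hS hSu => ?_⟩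
  refine (hx.cut (proj Q r ⁻¹' S) (hS.preimage (proj_surjective hr)) ?_).trans_eq ?_
  · intro h1
    refine hSu (Set.eq_univ_of_forall fun w => ?_)
    obtain ⟨v, rfl⟩ := proj_surjective hr w
    have h2 := Set.mem_univ v
    rwa [← h1] at h2
  · refine Finset.sum_congr rfl fun t _ => ?_
    by_cases h1 : G.Crosses (proj Q r ⁻¹' S) t
    · simp [h1, crosses_contract_iff, h1.not_inside]
    · simp [h1, crosses_contract_iff]

lemma IsRooted.connected_union {f : W → ι} {s : W} (hf : G.IsRooted f s) {R : Set ι}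
    (hR : (G.contract (G.reachSet f s) s).Connected R) :
    G.Connected (R ∪ f '' G.reachSet f s) := by
  intro S hS hSu
  have hsQ : s ∈ G.reachSet f s := ReflTransGen.refl
  by_cases hsplit : ∃ a ∈ G.reachSet f s, ∃ b ∈ G.reachSet f s, a ∈ S ∧ b ∉ S
  · obtain ⟨a, ha, b, hb, haS, hbS⟩ := hsplit
    obtain ⟨u, v, hau, huv, hu, hv⟩ := exists_cut_edge ((hf.reach a).trans hb) haS hbS
    exact ⟨f u, Or.inr ⟨u, ReflTransGen.trans ha hau, rfl⟩, by rwa [hf.source], v, huv, hv⟩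
  · push Not at hsplit
    have hpre : proj (G.reachSet f s) s ⁻¹' (Subtype.val ⁻¹' S) = S := by
      ext w
      by_cases hw : w ∈ G.reachSet f s
      · rw [Set.mem_preimage, Set.mem_preimage, coe_proj_of_mem hw]
        exact ⟨hsplit s hsQ w hw, hsplit w hw s hsQ⟩
      · rw [Set.mem_preimage, Set.mem_preimage, coe_proj_of_notMem hw]
    obtain ⟨t, ht, hcross⟩ := hR (Subtype.val ⁻¹' S)
      (by
        rw [← hpre] at hS
        obtain ⟨w, hw⟩ := hS
        exact ⟨_, hw⟩)
      (fun h1 => hSu (by rw [← hpre, h1, Set.preimage_univ]))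
    rw [crosses_contract_iff, hpre] at hcross
    exact ⟨t, Or.inl ht, hcross⟩

lemma ncard_insert_compl [Finite W] {Q : Set W} {r : W} (hr : r ∈ Q) :
    Nat.card ↥(insert r Qᶜ) + Q.ncard = Nat.card W + 1 := by
  rw [Nat.card_coe_set_eq, Set.ncard_insert_of_notMem (fun h : r ∈ Qᶜ => h hr) (Set.toFinite _),
    ← Set.ncard_add_ncard_compl Q]
  omega

universe u v

lemma IsFractional.exists_connected_le {ι : Type v} [Fintype ι] (n : ℕ) :
    ∀ {W : Type u} [Finite W] [Nonempty W] {G : StarSystem W ι} {x : ι → ℝ},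
      G.IsFractional x → Nat.card W = n →
      ∃ R : Finset ι, G.Connected (R : Set ι) ∧
        (R.card : ℝ) ≤ 6 / 5 * (Nat.card W - 1) + 2 / 5 * ∑ t, x t := by
  classical
  induction n using Nat.strong_induction_on with
  | _ n ih =>
    intro W _ _ G x hx hn
    rcases subsingleton_or_nontrivial W with hW | hW
    · refine ⟨∅, fun S hS hSu => ?_, ?_⟩
      · exact absurd (Subsingleton.eq_univ_of_nonempty hS) hSu
      · have h1 := Finset.sum_nonneg (s := Finset.univ) fun t _ => hx.nonneg t
        have h2 : (1 : ℝ) ≤ Nat.card W := by exact_mod_cast Nat.card_pos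
        simp only [Finset.card_empty, Nat.cast_zero]
        linarith
    · obtain ⟨f, s, hf, hpay⟩ := hx.exists_paysFor
      have hsQ : s ∈ G.reachSet f s := ReflTransGen.refl
      generalize hQ : G.reachSet f s = Q at hpay hsQ
      have hcard := ncard_insert_compl hsQ
      have hQ2 : 2 ≤ Q.ncard := by
        rcases hpay with h1 | h1 <;> omega
      obtain ⟨R, hR, hle⟩ := ih _ (by omega) (hx.contract hsQ) rfl
      refine ⟨R ∪ Q.toFinite.toFinset.image f, ?_, ?_⟩
      · subst hQ
        simpa using hf.connected_union hR
      · have h1 : (R ∪ Q.toFinite.toFinset.image f).card ≤ R.card + Q.ncard := by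
          refine (Finset.card_union_le _ _).trans (Nat.add_le_add_left ?_ _)
          rw [Set.ncard_eq_toFinset_card Q]
          exact Finset.card_image_le
        have h2 : ∑ t, {t | G.Inside Q t}ᶜ.indicator x t + G.weightInside x Q = ∑ t, x t := by
          rw [weightInside, ← Finset.sum_add_distrib]
          refine Finset.sum_congr rfl fun t _ => ?_
          rw [add_comm]
          exact congrFun (Set.indicator_self_add_compl _ x) t
        have h3 : ((R ∪ Q.toFinite.toFinset.image f).card : ℝ) ≤ R.card + Q.ncard := by
          exact_mod_cast h1
        have h4 : (Nat.card ↥(insert s Qᶜ) : ℝ) + Q.ncard = Nat.card W + 1 := by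
          exact_mod_cast hcard
        rcases hpay with ⟨h5, h6⟩ | ⟨h5, h6⟩
        · have h7 : (4 : ℝ) ≤ Q.ncard := by exact_mod_cast h5
          linarith
        · have h7 : (2 : ℝ) ≤ Q.ncard := by exact_mod_cast h5
          linarith

lemma IsFractional.card_le_sum [Fintype W] [Nontrivial W] [Fintype ι] {x : ι → ℝ}
    (hx : G.IsFractional x) : (Fintype.card W : ℝ) ≤ ∑ t, x t := by
  classical
  calc (Fintype.card W : ℝ) = ∑ _w : W, (1 : ℝ) := by simp
    _ ≤ ∑ w : W, ∑ t, {t | G.Crosses {w} t}.indicator x t := by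
        refine Finset.sum_le_sum fun w _ => hx.cut {w} ⟨w, rfl⟩ fun h1 => ?_
        obtain ⟨b, hb⟩ := exists_ne w
        have h2 := Set.mem_univ b
        rw [← h1] at h2
        exact hb h2
    _ ≤ ∑ w : W, ∑ t, if G.source t = w then x t else 0 := by
        refine Finset.sum_le_sum fun w _ => Finset.sum_le_sum fun t _ => ?_
        by_cases h1 : G.Crosses {w} t
        · have h2 : G.source t = w := h1.1
          simp [h1, h2]
        · rw [Set.indicator_of_notMem (s := {t | G.Crosses {w} t}) h1]
          split_ifs
          · exact hx.nonneg t
          · exact le_rfl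
    _ = ∑ t, x t := by
        rw [Finset.sum_comm]
        simp

/-- The star system given by a collection of stars in the sense of `IsStar`. -/
noncomputable def ofStars {V : Type*} {𝒞 : Finset (Finset (V × V))}
    (h : ∀ F ∈ 𝒞, IsStar F) : StarSystem V {F // F ∈ 𝒞} where
  source F := (h F.1 F.2).1.choose.1
  sinks F := {v | ∃ a ∈ F.1, a.2 = v}

lemma fst_eq_source {V : Type*} {𝒞 : Finset (Finset (V × V))} (h : ∀ F ∈ 𝒞, IsStar F)
    (F : {F // F ∈ 𝒞}) {a : V × V} (ha : a ∈ F.1) : a.1 = (ofStars h).source F :=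
  (h F.1 F.2).2.1 a ha _ (h F.1 F.2).1.choose_spec

lemma crosses_ofStars_iff {V : Type*} [DecidableEq V] {𝒞 : Finset (Finset (V × V))}
    (h : ∀ F ∈ 𝒞, IsStar F) (F : {F // F ∈ 𝒞}) (S : Finset V) :
    (ofStars h).Crosses S F ↔ F.1 ∈ cutStars 𝒞 S := by
  rw [cutStars, Finset.mem_filter]
  constructor
  · rintro ⟨hs, v, ⟨a, ha, rfl⟩, hv⟩
    exact ⟨F.2, ⟨a, ha, by rw [fst_eq_source h F ha]; exact hs⟩, a, ha, hv⟩
  · rintro ⟨-, ⟨a, ha, haS⟩, b, hb, hbS⟩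
    exact ⟨by rw [← fst_eq_source h F ha]; exact haS, b.2, ⟨b, hb, rfl⟩, hbS⟩

lemma sConn_of_connected {V : Type*} [DecidableEq V] {𝒞 : Finset (Finset (V × V))}
    (h : ∀ F ∈ 𝒞, IsStar F) {R : Finset {F // F ∈ 𝒞}}
    (hR : (ofStars h).Connected (R : Set {F // F ∈ 𝒞})) :
    SConn ((R.image Subtype.val).biUnion id) := by
  intro u v
  by_contra huv
  obtain ⟨F, hF, hs, w, ⟨a, ha, rfl⟩, hw⟩ :=
    hR {w | SReach ((R.image Subtype.val).biUnion id) u w} ⟨u, ReflTransGen.refl⟩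
      (fun h1 => huv (h1.symm ▸ Set.mem_univ v :
        v ∈ {w | SReach ((R.image Subtype.val).biUnion id) u w}))
  refine hw (ReflTransGen.tail hs ?_)
  rw [← fst_eq_source h F ha]
  exact Finset.mem_biUnion.2 ⟨F.1, Finset.mem_image_of_mem _ hF, ha⟩

lemma isFractional_ofStars {V : Type*} [Fintype V] [DecidableEq V]
    {𝒞 : Finset (Finset (V × V))} (h : ∀ F ∈ 𝒞, IsStar F) {x : Finset (V × V) → ℝ}
    (hx : ∀ F ∈ 𝒞, 0 ≤ x F)
    (hcut : ∀ S : Finset V, S.Nonempty → S ≠ Finset.univ → 1 ≤ ∑ F ∈ cutStars 𝒞 S, x F) :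
    (ofStars h).IsFractional fun F => x F.1 := by
  classical
  refine ⟨fun F => hx F.1 F.2, fun S hS hSu => ?_⟩
  obtain ⟨S, rfl⟩ := S.toFinite.exists_finset_coe
  refine (hcut S (by simpa using hS) (by simpa using hSu)).trans_eq ?_
  have h1 : cutStars 𝒞 S = 𝒞.filter (· ∈ cutStars 𝒞 S) := by
    ext F
    simp [cutStars]
  rw [h1, Finset.sum_filter,
    ← Finset.sum_coe_sort 𝒞 (fun F => if F ∈ cutStars 𝒞 S then x F else 0)]
  refine Finset.sum_congr rfl fun F _ => ?_
  simp [Set.indicator_apply, crosses_ofStars_iff]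

end StarSystem

end StarStrongConnectivity

theorem stmt11 {V : Type*} [Fintype V] [DecidableEq V]
    (E : Finset (V × V)) (𝒞 : Finset (Finset (V × V)))
    (hcard : 2 ≤ Fintype.card V)
    (hdig : IsDigraph E) (hconn : SConn E)
    (hstar : ∀ F ∈ 𝒞, IsStar F) (hcover : 𝒞.biUnion id = E) :
    ∃ R ⊆ 𝒞, SConn (R.biUnion id) ∧
      ∀ x : Finset (V × V) → ℝ, (∀ F ∈ 𝒞, 0 ≤ x F) →
        (∀ S : Finset V, S.Nonempty → S ≠ Finset.univ →
          1 ≤ ∑ F ∈ cutStars 𝒞 S, x F) →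
        (R.card : ℝ) ≤ (8 / 5) * ∑ F ∈ 𝒞, x F := by
  classical
  have : Nontrivial V := Fintype.one_lt_card_iff_nontrivial.1 hcard
  obtain ⟨R, hR, hmin⟩ := Finset.exists_min_image
    (𝒞.powerset.filter fun R => SConn (R.biUnion id)) Finset.card
    ⟨𝒞, Finset.mem_filter.2 ⟨Finset.mem_powerset_self 𝒞, hcover ▸ hconn⟩⟩
  rw [Finset.mem_filter, Finset.mem_powerset] at hR
  refine ⟨R, hR.1, hR.2, fun x hx hcut => ?_⟩
  have hfrac := StarStrongConnectivity.StarSystem.isFractional_ofStars hstar hx hcut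
  obtain ⟨R', hconn', hle⟩ := hfrac.exists_connected_le _ rfl
  have hsum := hfrac.card_le_sum
  rw [Finset.sum_coe_sort 𝒞 x] at hle hsum
  have hcard_le : R.card ≤ R'.card := by
    refine (hmin (R'.image Subtype.val) (Finset.mem_filter.2 ⟨?_, ?_⟩)).trans
      Finset.card_image_le
    · rw [Finset.mem_powerset]
      intro F hF
      obtain ⟨F', -, rfl⟩ := Finset.mem_image.1 hF
      exact F'.2
    · exact StarStrongConnectivity.StarSystem.sConn_of_connected hstar hconn'
  have hcard_le' : (R.card : ℝ) ≤ R'.card := by exact_mod_cast hcard_le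
  rw [Nat.card_eq_fintype_card] at hle
  linarith
end

section
/- Every finite 2-edge-connected simple graph G with at least 3 vertices contains a cycle C and a vertex v of C such that every neighbor of v in G lies on C (so that the singleton cut {v} is internal to C: every edge of G with exactly one endpoint equal to v has both endpoints among the vertices of C). -/
def TwoEdgeConnected {V : Type*} [Fintype V] (G : SimpleGraph V) : Prop :=
  2 ≤ Fintype.card V ∧ G.Connected ∧ ∀ e ∈ G.edgeSet, (G.deleteEdges {e}).Connected

/-- All neighbours of the start of a path of maximum length lie on that path. -/
theorem SimpleGraph.Walk.IsPath.mem_support_of_adj_of_forall_length_le {V : Type*}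
    {G : SimpleGraph V} {u v w : V} {p : G.Walk u v} (hp : p.IsPath)
    (hmax : ∀ (a b : V) (q : G.Walk a b), q.IsPath → q.length ≤ p.length) (h : G.Adj u w) :
    w ∈ p.support := by
  by_contra hw
  have := hmax _ _ (.cons h.symm p) (hp.cons hw)
  simp at this

/-- Every vertex of a 2-edge-connected graph has two distinct neighbours. -/
theorem TwoEdgeConnected.exists_adj_adj_ne {V : Type*} [Fintype V] {G : SimpleGraph V}
    (hG : TwoEdgeConnected G) (u : V) : ∃ a b : V, G.Adj u a ∧ G.Adj u b ∧ a ≠ b := by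
  obtain ⟨h2, hc, hdel⟩ := hG
  have : Nontrivial V := Fintype.one_lt_card_iff_nontrivial.mp h2
  obtain ⟨a, ha⟩ := hc.preconnected.exists_adj_of_nontrivial u
  obtain ⟨b, hb⟩ := (hdel s(u, a) ha).preconnected.exists_adj_of_nontrivial u
  rw [SimpleGraph.deleteEdges_adj] at hb
  exact ⟨a, b, ha, hb.1, fun hab => hb.2 (by simp [hab])⟩

theorem stmt15 {V : Type*} [Fintype V] [DecidableEq V]
    (G : SimpleGraph V)
    (hG : TwoEdgeConnected G) (hcard : 3 ≤ Fintype.card V) :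
    ∃ (u : V) (C : G.Walk u u), C.IsCycle ∧
      ∃ v ∈ C.support, ∀ w : V, G.Adj v w → w ∈ C.support := by
  have := hG.2.1.nonempty
  obtain ⟨u, v, p, hp, hmax⟩ := SimpleGraph.Walk.exists_isPath_forall_isPath_length_le_length G
  have hsupp {w : V} (hw : G.Adj u w) : w ∈ p.support :=
    hp.mem_support_of_adj_of_forall_length_le hmax hw
  obtain ⟨a, b, ha, hb, hab⟩ := hG.exists_adj_adj_ne u
  -- The neighbour `x` of `u` that lies furthest along `p` closes the cycle.
  obtain ⟨x, hx, hfar⟩ := Set.exists_max_image {w | G.Adj u w}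
    (fun w => p.support.idxOf w) (Set.toFinite _) ⟨a, ha⟩
  have hmem {w : V} (hw : G.Adj u w) : w ∈ (p.takeUntil x (hsupp hx)).support := by
    rw [SimpleGraph.Walk.takeUntil_eq_take, SimpleGraph.Walk.support_copy,
      SimpleGraph.Walk.support_take]
    exact (List.mem_take_iff_idxOf_lt (hsupp hw)).mpr (Nat.lt_succ_of_le (hfar w hw))
  have hq := hp.takeUntil (hsupp hx)
  refine ⟨x, .cons (SimpleGraph.Adj.symm hx) (p.takeUntil x (hsupp hx)), ?_, u, by simp,
    fun w hw => List.mem_cons_of_mem _ (hmem hw)⟩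
  rw [SimpleGraph.Walk.cons_isCycle_iff]
  refine ⟨hq, fun hedge => hab ?_⟩
  rw [Sym2.eq_swap] at hedge
  have hlen := hq.length_eq_one_of_mem_edges hedge
  have hx_of_adj {w : V} (hw : G.Adj u w) : w = x := by
    obtain ⟨n, hn, hle⟩ := SimpleGraph.Walk.mem_support_iff_exists_getVert.mp (hmem hw)
    obtain rfl | hn1 : n = 0 ∨ n = (p.takeUntil x (hsupp hx)).length := by lia
    · exact absurd (by simpa using hn) hw.ne
    · rw [← hn, hn1, SimpleGraph.Walk.getVert_length]
  exact (hx_of_adj ha).trans (hx_of_adj hb).symm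
end
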